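/- Necessity part of the scaling theorem for the multiplicative kernel: Let ν₀ be a positive Radon measure on (0,∞) with ∫ x² ν₀(dx) = 1, let (ν_t)_{0≤t<1} be the solution of Smoluchowski's coagulation equation with kernel K=xy, and set V(t,x) = (∫₀^x y² ν_t(dy)) / (∫₀^∞ y² ν_t(dy)). Suppose there is a function λ(t) → ∞ as t → 1⁻ and a nontrivial probability distribution function V_* (nondecreasing, right-continuous, lim_{x→∞} V_*(x) = 1, V_*(x) < 1 for some x > 0) such that lim_{t→1⁻} V(t, λ(t)x) = V_*(x) at every point of continuity of V_*. Then there exist ρ ∈ (0,1] and a function L slowly varying at infinity such that ∫₀^x y³ ν₀(dy) ~ x^{1−ρ} L(x) as x → ∞. -/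

import Mathlib

/-!
Necessity part of the scaling theorem for Smoluchowski's coagulation equation
with multiplicative kernel K = xy, approaching the gelation time T_gel = 1.
-/

open MeasureTheory Filter Topology Set Real

noncomputable section

/-- comparison step for the abstract regular variation argument -/
lemma rv_step1 {ι : Type*} (l : Filter ι) (U H E : ℝ → ℝ) (c : ℝ → ℝ) (S : ℝ → ℝ → ℝ)
    (e x : ι → ℝ)
    (Umono : MonotoneOn U (Ioi 0))
    (he : Tendsto e l (𝓝[>] 0))
    (hx : ∀ᶠ i in l, 0 < x i)
    (cpos : ∀ᶠ ε in 𝓝[>] (0:ℝ), 0 < c ε)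
    (Spos : ∀ q, 0 < q → ∀ᶠ ε in 𝓝[>] (0:ℝ), 0 < S ε q)
    (h1 : ∀ q, 0 < q → Tendsto (fun ε => c ε * S ε q) (𝓝[>] 0) (𝓝 (H q)))
    (h2 : ∀ q, 0 < q → Tendsto (fun ε => U (S ε q) / ε) (𝓝[>] 0) (𝓝 (E q)))
    (Hcont : ContinuousOn H (Ioi 0)) (Emono : StrictMonoOn E (Ioi 0))
    (q : ℝ) (hq : 0 < q)
    (hU : Tendsto (fun i => U (x i) / e i) l (𝓝 (E q))) :
    Tendsto (fun i => c (e i) * x i) l (𝓝 (H q)) := by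
  have hepos : ∀ᶠ i in l, 0 < e i := he.eventually self_mem_nhdsWithin
  have hHc : ContinuousAt H q := Hcont.continuousAt (Ioi_mem_nhds hq)
  rw [tendsto_order]
  constructor
  · intro y hy
    have : ∀ᶠ p in 𝓝[<] q, y < H p ∧ 0 < p ∧ p < q := by
      refine ((hHc.tendsto.eventually (lt_mem_nhds hy)).filter_mono nhdsWithin_le_nhds).and ?_
      exact ((Ioi_mem_nhds hq : _ ∈ 𝓝 q) |> fun h => (mem_nhdsWithin_of_mem_nhds h : Ioi 0 ∈ 𝓝[<] q)) |> fun h =>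
        (Filter.inter_mem h self_mem_nhdsWithin)
    obtain ⟨p, hp1, hp0, hpq⟩ := this.exists
    have hE := Emono hp0 hq hpq
    obtain ⟨m, hm1, hm2⟩ := exists_between hE
    filter_upwards [he.eventually ((h1 p hp0).eventually (lt_mem_nhds hp1)),
      he.eventually ((h2 p hp0).eventually (gt_mem_nhds hm1)),
      hU.eventually (lt_mem_nhds hm2), hepos, hx, he.eventually cpos, he.eventually (Spos p hp0)]
      with i a1 a2 a3 a4 a5 a6 a7
    have : U (S (e i) p) < U (x i) := by
      have := a2.trans a3
      exact (div_lt_div_iff_of_pos_right a4).1 this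
    have : S (e i) p < x i := by
      by_contra hcon
      push Not at hcon
      exact absurd (Umono a5 a7 hcon) (not_le.2 this)
    exact a1.trans (mul_lt_mul_of_pos_left this a6)
  · intro y hy
    have : ∀ᶠ p in 𝓝[>] q, H p < y ∧ q < p := by
      exact ((hHc.tendsto.eventually (gt_mem_nhds hy)).filter_mono nhdsWithin_le_nhds).and self_mem_nhdsWithin
    obtain ⟨p, hp1, hpq⟩ := this.exists
    have hp0 := hq.trans hpq
    have hE := Emono hq hp0 hpq
    obtain ⟨m, hm1, hm2⟩ := exists_between hE
    filter_upwards [he.eventually ((h1 p hp0).eventually (gt_mem_nhds hp1)),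
      he.eventually ((h2 p hp0).eventually (lt_mem_nhds hm2)),
      hU.eventually (gt_mem_nhds hm1), hepos, hx, he.eventually cpos, he.eventually (Spos p hp0)]
      with i a1 a2 a3 a4 a5 a6 a7
    have : U (x i) < U (S (e i) p) := by
      have := a3.trans a2
      exact (div_lt_div_iff_of_pos_right a4).1 this
    have : x i < S (e i) p := by
      by_contra hcon
      push Not at hcon
      exact absurd (Umono a7 a5 hcon) (not_le.2 this)
    exact (mul_lt_mul_of_pos_left this a6).trans a1

lemma rv_step2 {ι : Type*} (l : Filter ι) (U H E : ℝ → ℝ) (c : ℝ → ℝ) (S : ℝ → ℝ → ℝ)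
    (e x : ι → ℝ)
    (Umono : MonotoneOn U (Ioi 0))
    (he : Tendsto e l (𝓝[>] 0))
    (hx : ∀ᶠ i in l, 0 < x i)
    (cpos : ∀ᶠ ε in 𝓝[>] (0:ℝ), 0 < c ε)
    (Spos : ∀ q, 0 < q → ∀ᶠ ε in 𝓝[>] (0:ℝ), 0 < S ε q)
    (h1 : ∀ q, 0 < q → Tendsto (fun ε => c ε * S ε q) (𝓝[>] 0) (𝓝 (H q)))
    (h2 : ∀ q, 0 < q → Tendsto (fun ε => U (S ε q) / ε) (𝓝[>] 0) (𝓝 (E q)))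
    (Econt : ContinuousOn E (Ioi 0)) (Hmono : StrictMonoOn H (Ioi 0))
    (q : ℝ) (hq : 0 < q)
    (hU : Tendsto (fun i => c (e i) * x i) l (𝓝 (H q))) :
    Tendsto (fun i => U (x i) / e i) l (𝓝 (E q)) := by
  have hepos : ∀ᶠ i in l, 0 < e i := he.eventually self_mem_nhdsWithin
  have hHc : ContinuousAt E q := Econt.continuousAt (Ioi_mem_nhds hq)
  rw [tendsto_order]
  constructor
  · intro y hy
    have : ∀ᶠ p in 𝓝[<] q, y < E p ∧ 0 < p ∧ p < q := by
      refine ((hHc.tendsto.eventually (lt_mem_nhds hy)).filter_mono nhdsWithin_le_nhds).and ?_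
      exact ((Ioi_mem_nhds hq : _ ∈ 𝓝 q) |> fun h => (mem_nhdsWithin_of_mem_nhds h : Ioi 0 ∈ 𝓝[<] q)) |> fun h =>
        (Filter.inter_mem h self_mem_nhdsWithin)
    obtain ⟨p, hp1, hp0, hpq⟩ := this.exists
    have hE := Hmono hp0 hq hpq
    obtain ⟨m, hm1, hm2⟩ := exists_between hE
    filter_upwards [he.eventually ((h2 p hp0).eventually (lt_mem_nhds hp1)),
      he.eventually ((h1 p hp0).eventually (gt_mem_nhds hm1)),
      hU.eventually (lt_mem_nhds hm2), hepos, hx, he.eventually cpos, he.eventually (Spos p hp0)]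
      with i a1 a2 a3 a4 a5 a6 a7
    have : S (e i) p < x i := lt_of_mul_lt_mul_left (a2.trans a3) a6.le
    have := Umono a7 a5 this.le
    exact a1.trans_le (div_le_div_of_nonneg_right this a4.le)
  · intro y hy
    have : ∀ᶠ p in 𝓝[>] q, E p < y ∧ q < p := by
      exact ((hHc.tendsto.eventually (gt_mem_nhds hy)).filter_mono nhdsWithin_le_nhds).and self_mem_nhdsWithin
    obtain ⟨p, hp1, hpq⟩ := this.exists
    have hp0 := hq.trans hpq
    have hE := Hmono hq hp0 hpq
    obtain ⟨m, hm1, hm2⟩ := exists_between hE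
    filter_upwards [he.eventually ((h2 p hp0).eventually (gt_mem_nhds hp1)),
      he.eventually ((h1 p hp0).eventually (lt_mem_nhds hm2)),
      hU.eventually (gt_mem_nhds hm1), hepos, hx, he.eventually cpos, he.eventually (Spos p hp0)]
      with i a1 a2 a3 a4 a5 a6 a7
    have : x i < S (e i) p := lt_of_mul_lt_mul_left (a3.trans a2) a6.le
    have := Umono a5 a7 this.le
    exact (div_le_div_of_nonneg_right this a4.le).trans_lt a1

lemma rv_main (U H E : ℝ → ℝ) (c : ℝ → ℝ) (S : ℝ → ℝ → ℝ)
    (Umono : MonotoneOn U (Ioi 0)) (Upos : ∀ a, 0 < a → 0 < U a)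
    (Uzero : Tendsto U (𝓝[>] 0) (𝓝 0))
    (cpos : ∀ᶠ ε in 𝓝[>] (0:ℝ), 0 < c ε)
    (Spos : ∀ q, 0 < q → ∀ᶠ ε in 𝓝[>] (0:ℝ), 0 < S ε q)
    (h1 : ∀ q, 0 < q → Tendsto (fun ε => c ε * S ε q) (𝓝[>] 0) (𝓝 (H q)))
    (h2 : ∀ q, 0 < q → Tendsto (fun ε => U (S ε q) / ε) (𝓝[>] 0) (𝓝 (E q)))
    (Hcont : ContinuousOn H (Ioi 0)) (Emono : StrictMonoOn E (Ioi 0))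
    (Econt : ContinuousOn E (Ioi 0)) (Hmono : StrictMonoOn H (Ioi 0))
    (Hpos : ∀ q, 0 < q → 0 < H q) (Hle : ∀ q, 0 < q → H q ≤ q)
    (Epos : ∀ q, 0 < q → 0 < E q)
    (z : ℝ) (hz : z ∈ Ioo (0:ℝ) 1) :
    ∃ r ∈ Ioo (0:ℝ) 1, Tendsto (fun a => U (z * a) / U a) (𝓝[>] 0) (𝓝 r) := by
  have hE1 := Epos 1 one_pos
  have hH1 := Hpos 1 one_pos
  have hapos : ∀ᶠ a in 𝓝[>] (0:ℝ), 0 < a := self_mem_nhdsWithin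
  set e : ℝ → ℝ := fun a => U a / E 1 with hedef
  have he : Tendsto e (𝓝[>] 0) (𝓝[>] 0) := by
    refine tendsto_nhdsWithin_iff.2 ⟨?_, ?_⟩
    · simpa using Uzero.div_const (E 1)
    · filter_upwards [hapos] with a ha
      exact div_pos (Upos a ha) hE1
  have hc := rv_step1 (𝓝[>] 0) U H E c S e id Umono he hapos cpos Spos h1 h2 Hcont Emono 1 one_pos
    (by
      refine tendsto_const_nhds.congr' ?_
      filter_upwards [hapos] with a ha
      have := (Upos a ha).ne'
      simp only [hedef, id]
      field_simp)
  -- choose q1 with H q1 = z * H 1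
  obtain ⟨q1, ⟨hq1, hq1'⟩, hHq1⟩ : ∃ q ∈ Ioo (0:ℝ) 1, H q = z * H 1 := by
    set q0 := z * H 1 / 2
    have hq0 : 0 < q0 := by have := hz.1; positivity
    have hlt : H q0 < z * H 1 := by
      have := Hle q0 hq0
      have : 0 < z * H 1 := mul_pos hz.1 hH1
      have : q0 < z * H 1 := by simp only [q0]; linarith
      linarith
    have hlt2 : z * H 1 < H 1 := by nlinarith [hz.2]
    have hq01 : q0 < 1 := by
      have := Hle 1 one_pos
      simp only [q0]; nlinarith [hz.1, hz.2]
    obtain ⟨q, hq, hqe⟩ := intermediate_value_Ioo hq01.le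
      (Hcont.mono (fun x hx => hq0.trans_le hx.1)) ⟨hlt, hlt2⟩
    exact ⟨q, ⟨hq0.trans hq.1, hq.2⟩, hqe⟩
  have hcz : Tendsto (fun a => c (e a) * (z * a)) (𝓝[>] 0) (𝓝 (H q1)) := by
    rw [hHq1]
    refine (hc.const_mul z).congr (fun a => ?_)
    simp only [id]; ring
  have hfin := rv_step2 (𝓝[>] 0) U H E c S e (fun a => z * a) Umono he
    (by filter_upwards [hapos] with a ha; exact mul_pos hz.1 ha) cpos Spos h1 h2 Econt Hmono q1 hq1 hcz
  refine ⟨E q1 / E 1, ⟨div_pos (Epos _ hq1) hE1, (div_lt_one hE1).2 (Emono hq1 (mem_Ioi.2 one_pos) hq1')⟩, ?_⟩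
  refine (hfin.div_const (E 1)).congr' ?_
  filter_upwards [hapos] with a ha
  have := (Upos a ha).ne'
  simp only [hedef]
  field_simp

lemma rv_power (U : ℝ → ℝ) (Umono : MonotoneOn U (Ioi 0)) (Upos : ∀ a, 0 < a → 0 < U a)
    (h : ∀ z ∈ Ioo (0:ℝ) 1, ∃ r ∈ Ioo (0:ℝ) 1, Tendsto (fun a => U (z * a) / U a) (𝓝[>] 0) (𝓝 r)) :
    ∃ ρ : ℝ, 0 < ρ ∧ ∀ z, 0 < z → Tendsto (fun a => U (z * a) / U a) (𝓝[>] 0) (𝓝 (z ^ ρ)) := by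
  have hapos : ∀ᶠ a in 𝓝[>] (0:ℝ), 0 < a := self_mem_nhdsWithin
  have hscale : ∀ z : ℝ, 0 < z → Tendsto (fun a : ℝ => z * a) (𝓝[>] 0) (𝓝[>] 0) := by
    intro z hz
    refine tendsto_nhdsWithin_iff.2 ⟨?_, ?_⟩
    · have : Tendsto (fun a : ℝ => z * a) (𝓝 0) (𝓝 (z * 0)) := tendsto_id.const_mul z
      rw [mul_zero] at this
      exact this.mono_left nhdsWithin_le_nhds
    · filter_upwards [hapos] with a ha using mul_pos hz ha
  have hall : ∀ z, 0 < z → ∃ r, 0 < r ∧ Tendsto (fun a => U (z * a) / U a) (𝓝[>] 0) (𝓝 r) := by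
    intro z hz
    rcases lt_trichotomy z 1 with h1 | h1 | h1
    · obtain ⟨r, hr, hr'⟩ := h z ⟨hz, h1⟩
      exact ⟨r, hr.1, hr'⟩
    · refine ⟨1, one_pos, tendsto_const_nhds.congr' ?_⟩
      filter_upwards [hapos] with a ha
      rw [h1, one_mul, div_self (Upos a ha).ne']
    · obtain ⟨r, hr, hr'⟩ := h z⁻¹ ⟨inv_pos.2 hz, inv_lt_one_of_one_lt₀ h1⟩
      refine ⟨r⁻¹, inv_pos.2 hr.1, ?_⟩
      have := (hr'.comp (hscale z hz)).inv₀ hr.1.ne'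
      refine this.congr (fun a => ?_)
      simp only [Function.comp]
      rw [inv_div, inv_mul_cancel_left₀ hz.ne']
  choose! r hr hrt using hall
  have hmul : ∀ y z, 0 < y → 0 < z → r (y * z) = r y * r z := by
    intro y z hy hz
    refine tendsto_nhds_unique (hrt (y * z) (mul_pos hy hz)) ?_
    have := ((hrt y hy).comp (hscale z hz)).mul (hrt z hz)
    refine this.congr' ?_
    filter_upwards [hapos] with a ha
    have h1 := (Upos (z * a) (mul_pos hz ha)).ne'
    have h2 := (Upos a ha).ne'
    simp only [Function.comp, mul_assoc]
    field_simp
  have hmon : ∀ y z, 0 < y → y ≤ z → r y ≤ r z := by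
    intro y z hy hyz
    refine le_of_tendsto_of_tendsto (hrt y hy) (hrt z (hy.trans_le hyz)) ?_
    filter_upwards [hapos] with a ha
    refine div_le_div_of_nonneg_right ?_ (Upos a ha).le
    exact Umono (mul_pos hy ha) (mul_pos (hy.trans_le hyz) ha) (mul_le_mul_of_nonneg_right hyz ha.le)
  let A : ℝ →+ ℝ := AddMonoidHom.mk' (fun x => Real.log (r (Real.exp x))) (by
    intro x y
    rw [Real.exp_add, hmul _ _ (exp_pos x) (exp_pos y),
      Real.log_mul (hr _ (exp_pos x)).ne' (hr _ (exp_pos y)).ne'])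
  have hAmono : Monotone A := by
    intro x y hxy
    exact Real.log_le_log (hr _ (exp_pos x)) (hmon _ _ (exp_pos x) (Real.exp_le_exp.2 hxy))
  have hAcont : Continuous A := MeasureTheory.Measure.AddMonoidHom.continuous_of_measurable A hAmono.measurable
  have hlin : ∀ x, A x = x * A 1 := by
    intro x
    have := (A.toRealLinearMap hAcont).map_smul x 1
    simpa using this
  have hpow : ∀ z, 0 < z → r z = z ^ (A 1) := by
    intro z hz
    have h1 := hlin (Real.log z)
    have h2 : A (Real.log z) = Real.log (r z) := by
      change Real.log (r (Real.exp (Real.log z))) = _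
      rw [Real.exp_log hz]
    rw [Real.rpow_def_of_pos hz, ← h1, h2, Real.exp_log (hr z hz)]
  refine ⟨A 1, ?_, fun z hz => hpow z hz ▸ hrt z hz⟩
  obtain ⟨s, hs, hs'⟩ := h (1/2) (by norm_num)
  have : r (1/2) = s := tendsto_nhds_unique (hrt _ (by norm_num)) hs'
  by_contra hcon
  push Not at hcon
  have h3 := hpow (1/2) (by norm_num)
  have : (1:ℝ) ≤ (1/2:ℝ) ^ (A 1) := Real.one_le_rpow_of_pos_of_le_one_of_nonpos (by norm_num) (by norm_num) hcon
  linarith [hs.2]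

lemma mono_density {ι : Type*} (l : Filter ι) [l.NeBot] (R : ι → ℝ) (Q : ℝ → ι → ℝ) (α : ℝ)
    (hQ : ∀ z, 0 < z → Tendsto (Q z) l (𝓝 (z ^ α)))
    (h1 : ∃ᶠ z in 𝓝[≠] (1:ℝ), ∀ᶠ a in l, R a ≤ (Q z a - 1) / (z - 1))
    (h2 : ∃ᶠ z in 𝓝[≠] (1:ℝ), ∀ᶠ a in l, (Q z a - 1) / (z - 1) ≤ R a) :
    Tendsto R l (𝓝 α) := by
  have hd : HasDerivAt (fun z : ℝ => z ^ α) α 1 := by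
    simpa using Real.hasDerivAt_rpow_const (x := 1) (p := α) (Or.inl one_ne_zero)
  have hs := hasDerivAt_iff_tendsto_slope.1 hd
  have hpos : ∀ᶠ z in 𝓝[≠] (1:ℝ), 0 < z := mem_nhdsWithin_of_mem_nhds (Ioi_mem_nhds one_pos)
  have hlim : ∀ z, 0 < z → Tendsto (fun a => (Q z a - 1) / (z - 1)) l
      (𝓝 (slope (fun z : ℝ => z ^ α) 1 z)) := by
    intro z hz
    have := ((hQ z hz).sub_const 1).div_const (z - 1)
    simpa [slope_def_field] using this
  rw [tendsto_order]
  constructor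
  · intro y hy
    obtain ⟨z, hz1, hz2, hz3⟩ := (h2.and_eventually ((hs.eventually (lt_mem_nhds hy)).and hpos)).exists
    filter_upwards [hz1, (hlim z hz3).eventually (lt_mem_nhds hz2)] with a b1 b2
    exact b2.trans_le b1
  · intro y hy
    obtain ⟨z, hz1, hz2, hz3⟩ := (h1.and_eventually ((hs.eventually (gt_mem_nhds hy)).and hpos)).exists
    filter_upwards [hz1, (hlim z hz3).eventually (gt_mem_nhds hz2)] with a b1 b2
    exact b1.trans_lt b2

lemma freq_gt {p : ℝ → Prop} (h : ∀ z, 1 < z → p z) : ∃ᶠ z in 𝓝[≠] (1:ℝ), p z := by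
  have : ∃ᶠ z in 𝓝[>] (1:ℝ), p z :=
    (Filter.Eventually.frequently (by filter_upwards [self_mem_nhdsWithin] with z hz using h z hz))
  exact this.filter_mono (nhdsWithin_mono _ (fun x hx => ne_of_gt hx))

lemma freq_lt {p : ℝ → Prop} (h : ∀ z, 0 < z → z < 1 → p z) : ∃ᶠ z in 𝓝[≠] (1:ℝ), p z := by
  have : ∃ᶠ z in 𝓝[<] (1:ℝ), p z := by
    refine Filter.Eventually.frequently ?_
    filter_upwards [self_mem_nhdsWithin,
      (mem_nhdsWithin_of_mem_nhds (Ioi_mem_nhds one_pos) : Ioi (0:ℝ) ∈ 𝓝[<] (1:ℝ))] with z hz hz'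
      using h z hz' hz
  exact this.filter_mono (nhdsWithin_mono _ (fun x hx => ne_of_lt hx))

/-- monotone density theorem at zero: convex (s = 1) and concave (s = -1) version -/
lemma density_index (s : ℝ) (hs : s = 1 ∨ s = -1) (f g : ℝ → ℝ) (α : ℝ) (hα : 0 < α)
    (fpos : ∀ a, 0 < a → 0 < f a)
    (hf : ∀ z, 0 < z → Tendsto (fun a => f (z * a) / f a) (𝓝[>] 0) (𝓝 (z ^ α)))
    (htan : ∀ a b, 0 < a → 0 < b → s * ((b - a) * g a) ≤ s * (f b - f a)) :
    Tendsto (fun a => a * g a / f a) (𝓝[>] 0) (𝓝 α) ∧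
    ∀ z, 0 < z → Tendsto (fun a => g (z * a) / g a) (𝓝[>] 0) (𝓝 (z ^ (α - 1))) := by
  have hapos : ∀ᶠ a in 𝓝[>] (0:ℝ), 0 < a := self_mem_nhdsWithin
  have hkey : ∀ z a, 0 < z → 0 < a → s * ((z - 1) * (a * g a / f a)) ≤ s * (f (z * a) / f a - 1) := by
    intro z a hz ha
    have h1 := htan a (z * a) ha (mul_pos hz ha)
    have h2 := fpos a ha
    have h3 := div_le_div_of_nonneg_right h1 h2.le
    calc s * ((z - 1) * (a * g a / f a)) = s * ((z * a - a) * g a) / f a := by ring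
      _ ≤ _ := h3
      _ = _ := by field_simp
  have hR : Tendsto (fun a => a * g a / f a) (𝓝[>] 0) (𝓝 α) := by
    rcases hs with rfl | rfl
    · refine mono_density _ _ (fun z a => f (z * a) / f a) α hf (freq_gt ?_) (freq_lt ?_)
      · intro z hz
        filter_upwards [hapos] with a ha
        have := hkey z a (by linarith) ha
        rw [le_div_iff₀ (by linarith)]
        linarith
      · intro z hz hz'
        filter_upwards [hapos] with a ha
        have := hkey z a hz ha
        rw [div_le_iff_of_neg (by linarith)]
        linarith
    · refine mono_density _ _ (fun z a => f (z * a) / f a) α hf (freq_lt ?_) (freq_gt ?_)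
      · intro z hz hz'
        filter_upwards [hapos] with a ha
        have := hkey z a hz ha
        rw [le_div_iff_of_neg (by linarith)]
        linarith
      · intro z hz
        filter_upwards [hapos] with a ha
        have := hkey z a (by linarith) ha
        rw [div_le_iff₀ (by linarith)]
        linarith
  refine ⟨hR, fun z hz => ?_⟩
  have hscale : Tendsto (fun a : ℝ => z * a) (𝓝[>] 0) (𝓝[>] 0) := by
    refine tendsto_nhdsWithin_iff.2 ⟨?_, ?_⟩
    · have : Tendsto (fun a : ℝ => z * a) (𝓝 0) (𝓝 (z * 0)) := tendsto_id.const_mul z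
      rw [mul_zero] at this
      exact this.mono_left nhdsWithin_le_nhds
    · filter_upwards [hapos] with a ha using mul_pos hz ha
  have h1 := (((hR.comp hscale).div hR hα.ne').mul (hf z hz)).div_const z
  have h2 : α / α * z ^ α / z = z ^ (α - 1) := by
    rw [div_self hα.ne', one_mul, Real.rpow_sub_one hz.ne']
  rw [h2] at h1
  refine h1.congr' ?_
  filter_upwards [hapos, hR.eventually (lt_mem_nhds hα)] with a ha hb
  have e1 := (fpos a ha).ne'
  have e2 := (fpos _ (mul_pos hz ha)).ne'
  have e3 : g a ≠ 0 := by
    intro h0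
    rw [h0] at hb
    simp at hb
  simp only [Pi.div_apply, Function.comp_apply]
  field_simp

lemma int_of_sq {ν : Measure ℝ} (hpos : ∀ᵐ x ∂ν, 0 < x) (hint : Integrable (fun x => x ^ 2) ν)
    (F : ℝ → ℝ) (hF : Measurable F) (C : ℝ) (hC : ∀ x, 0 < x → |F x| ≤ C * x ^ 2) :
    Integrable F ν := by
  refine (hint.const_mul C).mono' hF.aestronglyMeasurable ?_
  filter_upwards [hpos] with x hx
  exact hC x hx

lemma int_pos {ν : Measure ℝ} (hpos : ∀ᵐ x ∂ν, 0 < x) (hne : ν ≠ 0)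
    (F : ℝ → ℝ) (hF : Integrable F ν) (h : ∀ x, 0 < x → 0 < F x) : 0 < ∫ x, F x ∂ν := by
  have h0 : 0 ≤ᵐ[ν] F := by filter_upwards [hpos] with x hx using (h x hx).le
  refine lt_of_le_of_ne (integral_nonneg_of_ae h0) (fun h1 => hne ?_)
  have h2 := (integral_eq_zero_iff_of_nonneg_ae h0 hF).1 h1.symm
  have : ∀ᵐ x ∂ν, False := by
    filter_upwards [hpos, h2] with x hx hx2
    exact absurd hx2 (h x hx).ne'
  simpa using this

lemma exp_tan (y z : ℝ) : -(z - y) * Real.exp (-y) ≤ Real.exp (-z) - Real.exp (-y) := by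
  have h := Real.add_one_le_exp (-(z - y))
  have h2 : Real.exp (-z) = Real.exp (-(z - y)) * Real.exp (-y) := by
    rw [← Real.exp_add]; congr 1; ring
  rw [h2]
  nlinarith [Real.exp_pos (-y)]

lemma int_psi {ν : Measure ℝ} (hpos : ∀ᵐ x ∂ν, 0 < x) (hint : Integrable (fun x => x ^ 2) ν)
    (a : ℝ) (ha : 0 ≤ a) : Integrable (fun x => (1 - Real.exp (-(a * x))) * x) ν := by
  refine int_of_sq hpos hint _ (by fun_prop) a (fun x hx => ?_)
  have h1 := Real.add_one_le_exp (-(a * x))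
  have h2 : Real.exp (-(a * x)) ≤ 1 := Real.exp_le_one_iff.2 (by nlinarith)
  rw [abs_of_nonneg (by nlinarith)]
  nlinarith

lemma int_u {ν : Measure ℝ} (hpos : ∀ᵐ x ∂ν, 0 < x) (hint : Integrable (fun x => x ^ 2) ν)
    (a : ℝ) (ha : 0 ≤ a) : Integrable (fun x => (1 - Real.exp (-(a * x))) * x ^ 2) ν := by
  refine int_of_sq hpos hint _ (by fun_prop) 1 (fun x hx => ?_)
  have h1 := Real.exp_pos (-(a * x))
  have h2 : Real.exp (-(a * x)) ≤ 1 := Real.exp_le_one_iff.2 (by nlinarith)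
  rw [abs_of_nonneg (mul_nonneg (by linarith) (sq_nonneg x))]
  nlinarith [sq_nonneg x]

lemma int_D {ν : Measure ℝ} (hpos : ∀ᵐ x ∂ν, 0 < x) (hint : Integrable (fun x => x ^ 2) ν)
    (a : ℝ) (ha : 0 < a) : Integrable (fun x => Real.exp (-(a * x)) * x ^ 3) ν := by
  refine int_of_sq hpos hint _ (by fun_prop) (1 / a) (fun x hx => ?_)
  have h1 := Real.exp_pos (-(a * x))
  have h3 : a * x * Real.exp (-(a * x)) ≤ 1 := by
    have h := Real.add_one_le_exp (a * x)
    rw [Real.exp_neg, ← div_eq_mul_inv, div_le_one (Real.exp_pos _)]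
    linarith
  rw [abs_of_nonneg (by positivity)]
  rw [div_mul_eq_mul_div, le_div_iff₀ ha]
  nlinarith [sq_nonneg x]

lemma tan_Phi {ν : Measure ℝ} (hpos : ∀ᵐ x ∂ν, 0 < x) (hint : Integrable (fun x => x ^ 2) ν)
    (h1 : ∫ x, x ^ 2 ∂ν = 1)
    (a b : ℝ) (ha : 0 ≤ a) (hb : 0 ≤ b) :
    (b - a) * (∫ x, (1 - Real.exp (-(a * x))) * x ^ 2 ∂ν) ≤
      (b - ∫ x, (1 - Real.exp (-(b * x))) * x ∂ν) - (a - ∫ x, (1 - Real.exp (-(a * x))) * x ∂ν) := by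
  have e1 : (b - a) = ∫ x, (b - a) * x ^ 2 ∂ν := by rw [integral_const_mul, h1, mul_one]
  have e2 : (b - ∫ x, (1 - Real.exp (-(b * x))) * x ∂ν) - (a - ∫ x, (1 - Real.exp (-(a * x))) * x ∂ν)
    = ∫ x, ((b - a) * x ^ 2 - (1 - Real.exp (-(b * x))) * x) + (1 - Real.exp (-(a * x))) * x ∂ν := by
    have i1 : Integrable (fun x => (b - a) * x ^ 2 - (1 - Real.exp (-(b * x))) * x) ν :=
      (hint.const_mul _).sub (int_psi hpos hint b hb)
    rw [integral_add i1 (int_psi hpos hint a ha),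
      integral_sub (hint.const_mul _) (int_psi hpos hint b hb), ← e1]
    ring
  rw [e2, ← integral_const_mul]
  refine integral_mono_ae ((int_u hpos hint a ha).const_mul _)
    (((hint.const_mul _).sub (int_psi hpos hint b hb)).add (int_psi hpos hint a ha)) ?_
  filter_upwards [hpos] with x hx
  have := exp_tan (a * x) (b * x)
  have := mul_le_mul_of_nonneg_right this hx.le
  nlinarith

lemma tan_u {ν : Measure ℝ} (hpos : ∀ᵐ x ∂ν, 0 < x) (hint : Integrable (fun x => x ^ 2) ν)
    (a b : ℝ) (ha : 0 < a) (hb : 0 ≤ b) :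
    (∫ x, (1 - Real.exp (-(b * x))) * x ^ 2 ∂ν) - (∫ x, (1 - Real.exp (-(a * x))) * x ^ 2 ∂ν) ≤
     (b - a) * (∫ x, Real.exp (-(a * x)) * x ^ 3 ∂ν) := by
  rw [← integral_sub (int_u hpos hint b hb) (int_u hpos hint a ha.le), ← integral_const_mul]
  refine integral_mono_ae ((int_u hpos hint b hb).sub (int_u hpos hint a ha.le))
    ((int_D hpos hint a ha).const_mul _) ?_
  filter_upwards [hpos] with x hx
  have := exp_tan (a * x) (b * x)
  have := mul_le_mul_of_nonneg_right this (sq_nonneg x)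
  nlinarith

lemma u_zero {ν : Measure ℝ} (hpos : ∀ᵐ x ∂ν, 0 < x) (hint : Integrable (fun x => x ^ 2) ν) :
    Tendsto (fun a => ∫ x, (1 - Real.exp (-(a * x))) * x ^ 2 ∂ν) (𝓝[>] 0) (𝓝 0) := by
  have : Tendsto (fun a => ∫ x, (1 - Real.exp (-(a * x))) * x ^ 2 ∂ν) (𝓝[>] 0)
      (𝓝 (∫ x, (0:ℝ) ∂ν)) := by
    refine tendsto_integral_filter_of_dominated_convergence (fun x => x ^ 2) ?_ ?_ hint ?_
    · exact Eventually.of_forall (fun a => by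
        have : Measurable (fun x : ℝ => (1 - Real.exp (-(a * x))) * x ^ 2) := by fun_prop
        exact this.aestronglyMeasurable)
    · filter_upwards [self_mem_nhdsWithin] with a ha
      filter_upwards [hpos] with x hx
      have ha' : 0 < a := ha
      have h1 := Real.exp_pos (-(a * x))
      have h2 : Real.exp (-(a * x)) ≤ 1 := Real.exp_le_one_iff.2 (by nlinarith)
      rw [Real.norm_of_nonneg (mul_nonneg (by linarith) (sq_nonneg x))]
      nlinarith [sq_nonneg x]
    · refine Eventually.of_forall (fun x => ?_)
      have : Continuous (fun a : ℝ => (1 - Real.exp (-(a * x))) * x ^ 2) := by fun_prop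
      have h := (this.tendsto 0).mono_left (nhdsWithin_le_nhds (s := Ioi 0))
      simpa using h
  simpa using this

/-- the limit law in the Karamata theorem -/
lemma limit_law (ρ : ℝ) (hρ : ρ ∈ Ioc (0:ℝ) 1) : ∃ P : Measure ℝ, IsProbabilityMeasure P ∧
    (∀ᵐ y ∂P, 0 ≤ y) ∧ (∀ᵐ y ∂P, y ≠ 1) ∧
    (∀ k : ℕ, ∫ y, Real.exp (-y) ^ k ∂P = ((k:ℝ) + 1) ^ (ρ - 1)) ∧ P (Iic 1) ≠ 0 := by
  rcases hρ.2.lt_or_eq with h | h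
  · have ha : 0 < 1 - ρ := by linarith
    have hprob := ProbabilityTheory.isProbabilityMeasure_gammaMeasure ha one_pos
    have hmeas : Measurable (ProbabilityTheory.gammaPDF (1 - ρ) 1) :=
      (ProbabilityTheory.measurable_gammaPDFReal _ _).ennreal_ofReal
    have hac : ProbabilityTheory.gammaMeasure (1 - ρ) 1 ≪ volume := withDensity_absolutelyContinuous _ _
    refine ⟨ProbabilityTheory.gammaMeasure (1 - ρ) 1, hprob, ?_, ?_, ?_, ?_⟩
    · rw [ProbabilityTheory.gammaMeasure, ae_withDensity_iff hmeas]
      refine Eventually.of_forall (fun y hy => ?_)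
      by_contra hc
      exact hy (by simp [ProbabilityTheory.gammaPDF, ProbabilityTheory.gammaPDFReal, hc])
    · exact hac.ae_le (show ∀ᵐ y : ℝ, y ≠ 1 by simp [ae_iff])
    · intro k
      rw [ProbabilityTheory.gammaMeasure]
      have : ∫ y, Real.exp (-y) ^ k ∂(volume.withDensity (ProbabilityTheory.gammaPDF (1 - ρ) 1)) =
          ∫ y, ProbabilityTheory.gammaPDFReal (1 - ρ) 1 y * Real.exp (-y) ^ k := by
        rw [integral_withDensity_eq_integral_toReal_smul
          hmeas
          (Eventually.of_forall (fun x => ENNReal.ofReal_lt_top))]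
        refine integral_congr_ae (Eventually.of_forall (fun y => ?_))
        simp only [smul_eq_mul, ProbabilityTheory.gammaPDF]
        rw [ENNReal.toReal_ofReal (ProbabilityTheory.gammaPDFReal_nonneg ha one_pos y)]
      rw [this, ← setIntegral_eq_integral_of_ae_compl_eq_zero (s := Ioi 0)]
      · have hk : (0:ℝ) < (k:ℝ) + 1 := by positivity
        have hG := Real.integral_rpow_mul_exp_neg_mul_Ioi ha hk
        have : ∀ y ∈ Ioi (0:ℝ), ProbabilityTheory.gammaPDFReal (1 - ρ) 1 y * Real.exp (-y) ^ k =
            (Real.Gamma (1 - ρ))⁻¹ * (y ^ ((1 - ρ) - 1) * Real.exp (-(((k:ℝ) + 1) * y))) := by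
          intro y hy
          have hy' : 0 ≤ y := le_of_lt hy
          simp only [ProbabilityTheory.gammaPDFReal, hy', if_true, one_rpow]
          rw [← Real.exp_nat_mul]
          have : Real.exp (-(((k:ℝ) + 1) * y)) = Real.exp (-(1 * y)) * Real.exp (k * -y) := by
            rw [← Real.exp_add]; congr 1; ring
          rw [this]; ring
        rw [setIntegral_congr_fun measurableSet_Ioi this, integral_const_mul, hG]
        have hΓ := (Real.Gamma_pos_of_pos ha).ne'
        rw [mul_comm, mul_assoc, mul_inv_cancel₀ hΓ, mul_one, one_div, Real.inv_rpow hk.le,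
          ← Real.rpow_neg hk.le]
        congr 1; ring
      · have : ∀ᵐ y : ℝ, y ≠ 0 := by simp [ae_iff]
        filter_upwards [this] with y hy hy2
        have : ¬ 0 ≤ y := fun h' => hy2 (lt_of_le_of_ne h' hy.symm)
        simp [ProbabilityTheory.gammaPDFReal, this]
    · rw [ProbabilityTheory.gammaMeasure, withDensity_apply _ measurableSet_Iic]
      intro h0
      rw [lintegral_eq_zero_iff hmeas] at h0
      have h1 : ∀ᵐ y ∂(volume.restrict (Iic (1:ℝ))), ¬ (y ∈ Ioo (0:ℝ) 1) := by
        filter_upwards [h0] with y hy hy2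
        have := ProbabilityTheory.gammaPDFReal_pos (a := 1 - ρ) (r := 1) ha one_pos hy2.1
        simp only [Pi.zero_apply, ProbabilityTheory.gammaPDF, ENNReal.ofReal_eq_zero] at hy
        linarith
      rw [ae_iff] at h1
      simp only [not_not] at h1
      change (volume.restrict (Iic (1:ℝ))) (Ioo (0:ℝ) 1) = 0 at h1
      rw [Measure.restrict_apply measurableSet_Ioo] at h1
      rw [inter_eq_left.2 (fun y hy => hy.2.le)] at h1
      simp at h1
  · refine ⟨Measure.dirac 0, inferInstance, ?_, ?_, ?_, ?_⟩
    · rw [ae_dirac_eq]; simp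
    · rw [ae_dirac_eq]; simp
    · intro k; simp [h]
    · simp

lemma exp_neg_mem (y : ℝ) (hy : 0 ≤ y) : Real.exp (-y) ∈ Icc (0:ℝ) 1 :=
  ⟨(Real.exp_pos _).le, Real.exp_le_one_iff.2 (by linarith)⟩

lemma kar_int {ν : Measure ℝ} (hpos : ∀ᵐ x ∂ν, 0 < x) (hint : Integrable (fun x => x ^ 2) ν)
    (a : ℝ) (ha : 0 < a) (f : ℝ → ℝ) (hf : Measurable f) (C : ℝ) (hC : ∀ z ∈ Icc (0:ℝ) 1, |f z| ≤ C) :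
    Integrable (fun x => f (Real.exp (-(a * x))) * (Real.exp (-(a * x)) * x ^ 3)) ν := by
  refine (int_D hpos hint a ha).bdd_mul (c := C) ?_ ?_
  · exact (hf.comp (by fun_prop : Measurable (fun x : ℝ => Real.exp (-(a * x))))).aestronglyMeasurable
  · filter_upwards [hpos] with x hx
    exact hC _ (exp_neg_mem _ (mul_pos ha hx).le)

lemma P_int {P : Measure ℝ} [IsProbabilityMeasure P] (hP0 : ∀ᵐ y ∂P, 0 ≤ y)
    (f : ℝ → ℝ) (hf : Measurable f) (C : ℝ) (hC : ∀ z ∈ Icc (0:ℝ) 1, |f z| ≤ C) :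
    Integrable (fun y => f (Real.exp (-y))) P := by
  refine Integrable.of_bound (C := C) ?_ ?_
  · exact (hf.comp (by fun_prop : Measurable (fun x : ℝ => Real.exp (-x)))).aestronglyMeasurable
  · filter_upwards [hP0] with x hx
    exact hC _ (exp_neg_mem _ hx)

lemma cont_bdd (f : ℝ → ℝ) (hf : Continuous f) : ∃ C, ∀ z ∈ Icc (0:ℝ) 1, |f z| ≤ C :=
  (isCompact_Icc (a := (0:ℝ)) (b := 1)).exists_bound_of_continuousOn hf.continuousOn

lemma kar_poly {ν : Measure ℝ} (hpos : ∀ᵐ x ∂ν, 0 < x) (hint : Integrable (fun x => x ^ 2) ν)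
    (ρ : ℝ)
    (hD : ∀ z, 0 < z → Tendsto (fun a => (∫ x, Real.exp (-(z * a * x)) * x ^ 3 ∂ν) /
      (∫ x, Real.exp (-(a * x)) * x ^ 3 ∂ν)) (𝓝[>] 0) (𝓝 (z ^ (ρ - 1))))
    (P : Measure ℝ) [IsProbabilityMeasure P] (hP0 : ∀ᵐ y ∂P, 0 ≤ y)
    (hPk : ∀ k : ℕ, ∫ y, Real.exp (-y) ^ k ∂P = ((k:ℝ) + 1) ^ (ρ - 1)) (p : Polynomial ℝ) :
    Tendsto (fun a => (∫ x, p.eval (Real.exp (-(a * x))) * (Real.exp (-(a * x)) * x ^ 3) ∂ν) /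
      (∫ x, Real.exp (-(a * x)) * x ^ 3 ∂ν)) (𝓝[>] 0) (𝓝 (∫ y, p.eval (Real.exp (-y)) ∂P)) := by
  induction p using Polynomial.induction_on' with
  | add p q hp hq =>
    obtain ⟨C1, h1⟩ := cont_bdd _ p.continuous
    obtain ⟨C2, h2⟩ := cont_bdd _ q.continuous
    have e : ∫ y, (p + q).eval (Real.exp (-y)) ∂P =
        ∫ y, p.eval (Real.exp (-y)) ∂P + ∫ y, q.eval (Real.exp (-y)) ∂P := by
      rw [← integral_add (P_int hP0 _ p.continuous.measurable C1 h1)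
        (P_int hP0 _ q.continuous.measurable C2 h2)]
      simp
    rw [e]
    refine (hp.add hq).congr' ?_
    filter_upwards [self_mem_nhdsWithin] with a ha
    rw [← add_div, ← integral_add (kar_int hpos hint a ha _ p.continuous.measurable C1 h1)
      (kar_int hpos hint a ha _ q.continuous.measurable C2 h2)]
    simp [add_mul]
  | monomial n c =>
    simp only [Polynomial.eval_monomial]
    rw [integral_const_mul, hPk]
    refine ((hD ((n:ℝ) + 1) (by positivity)).const_mul c).congr (fun a => ?_)
    rw [← mul_div_assoc, ← integral_const_mul]
    congr 2
    ext x
    have : Real.exp (-(((n:ℝ) + 1) * a * x)) = Real.exp (-(a * x)) ^ n * Real.exp (-(a * x)) := by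
      rw [← Real.exp_nat_mul, ← Real.exp_add]; congr 1; ring
    rw [this]; ring

lemma kar_cont {ν : Measure ℝ} (hpos : ∀ᵐ x ∂ν, 0 < x) (hint : Integrable (fun x => x ^ 2) ν)
    (hne : ν ≠ 0)
    (ρ : ℝ)
    (hD : ∀ z, 0 < z → Tendsto (fun a => (∫ x, Real.exp (-(z * a * x)) * x ^ 3 ∂ν) /
      (∫ x, Real.exp (-(a * x)) * x ^ 3 ∂ν)) (𝓝[>] 0) (𝓝 (z ^ (ρ - 1))))
    (P : Measure ℝ) [IsProbabilityMeasure P] (hP0 : ∀ᵐ y ∂P, 0 ≤ y)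
    (hPk : ∀ k : ℕ, ∫ y, Real.exp (-y) ^ k ∂P = ((k:ℝ) + 1) ^ (ρ - 1)) (f : ℝ → ℝ)
    (hf : Continuous f) :
    Tendsto (fun a => (∫ x, f (Real.exp (-(a * x))) * (Real.exp (-(a * x)) * x ^ 3) ∂ν) /
      (∫ x, Real.exp (-(a * x)) * x ^ 3 ∂ν)) (𝓝[>] 0) (𝓝 (∫ y, f (Real.exp (-y)) ∂P)) := by
  obtain ⟨C, hC⟩ := cont_bdd f hf
  rw [Metric.tendsto_nhds]
  intro η hη
  obtain ⟨p, hp⟩ := exists_polynomial_near_of_continuousOn 0 1 f hf.continuousOn (η / 3) (by positivity)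
  obtain ⟨C1, hC1⟩ := cont_bdd _ p.continuous
  have hlim := Metric.tendsto_nhds.1 (kar_poly hpos hint ρ hD P hP0 hPk p) (η / 3) (by positivity)
  have b1 : |∫ y, p.eval (Real.exp (-y)) ∂P - ∫ y, f (Real.exp (-y)) ∂P| ≤ η / 3 := by
    rw [← integral_sub (P_int hP0 _ p.continuous.measurable C1 hC1) (P_int hP0 _ hf.measurable C hC)]
    have := norm_integral_le_of_norm_le_const (μ := P) (C := η / 3)
      (f := fun y => p.eval (Real.exp (-y)) - f (Real.exp (-y)))
      (by filter_upwards [hP0] with y hy using (hp _ (exp_neg_mem _ hy)).le)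
    simpa using this
  filter_upwards [hlim, self_mem_nhdsWithin] with a h1 ha
  have hDp : 0 < ∫ x, Real.exp (-(a * x)) * x ^ 3 ∂ν :=
    int_pos hpos hne _ (int_D hpos hint a ha) (fun x hx => by positivity)
  set Da := ∫ x, Real.exp (-(a * x)) * x ^ 3 ∂ν with hDa
  have b2 : |(∫ x, p.eval (Real.exp (-(a * x))) * (Real.exp (-(a * x)) * x ^ 3) ∂ν) / Da -
      (∫ x, f (Real.exp (-(a * x))) * (Real.exp (-(a * x)) * x ^ 3) ∂ν) / Da| ≤ η / 3 := by
    rw [← sub_div, abs_div, abs_of_pos hDp, div_le_iff₀ hDp,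
      ← integral_sub (kar_int hpos hint a ha _ p.continuous.measurable C1 hC1)
        (kar_int hpos hint a ha _ hf.measurable C hC), hDa, ← integral_const_mul]
    rw [← Real.norm_eq_abs]
    refine norm_integral_le_of_norm_le ((int_D hpos hint a ha).const_mul _) ?_
    filter_upwards [hpos] with x hx
    have hh := (hp _ (exp_neg_mem _ (mul_pos ha hx).le)).le
    rw [← sub_mul, norm_mul, Real.norm_of_nonneg (by positivity : 0 ≤ Real.exp (-(a * x)) * x ^ 3)]
    exact mul_le_mul_of_nonneg_right hh (by positivity)
  rw [Real.dist_eq] at h1 ⊢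
  rw [abs_lt] at h1 ⊢
  rw [abs_le] at b1 b2
  constructor <;> linarith [h1.1, h1.2, b1.1, b1.2, b2.1, b2.2]

/-- ramp functions -/
def ramp (s : ℝ) (n : ℕ) (z : ℝ) : ℝ :=
  max 0 (min 1 (((n:ℝ) + 1) * (z - Real.exp (-1)) + s)) / max z (Real.exp (-1))

lemma ramp_cont (s : ℝ) (n : ℕ) : Continuous (ramp s n) := by
  unfold ramp
  refine Continuous.div (by fun_prop) (by fun_prop) (fun z => ?_)
  exact (lt_max_of_lt_right (Real.exp_pos _)).ne'

lemma ramp_bdd (s : ℝ) (n : ℕ) (z : ℝ) : |ramp s n z| ≤ Real.exp 1 := by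
  unfold ramp
  have h0 : 0 < max z (Real.exp (-1)) := lt_max_of_lt_right (Real.exp_pos _)
  have h1 : 0 ≤ max 0 (min 1 (((n:ℝ) + 1) * (z - Real.exp (-1)) + s)) := le_max_left _ _
  have h2 : max 0 (min 1 (((n:ℝ) + 1) * (z - Real.exp (-1)) + s)) ≤ 1 :=
    max_le zero_le_one (min_le_left _ _)
  rw [abs_of_nonneg (div_nonneg h1 h0.le), div_le_iff₀ h0]
  have h3 : Real.exp (-1) ≤ max z (Real.exp (-1)) := le_max_right _ _
  have h4 : Real.exp 1 * Real.exp (-1) = 1 := by rw [← Real.exp_add]; simp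
  nlinarith [Real.exp_pos 1]

lemma ramp_lim (s : ℝ) (z : ℝ) (hz : z ≠ Real.exp (-1)) :
    Tendsto (fun n => ramp s n z) atTop (𝓝 (if Real.exp (-1) ≤ z then 1 / z else 0)) := by
  have hn : Tendsto (fun n : ℕ => (n:ℝ) + 1) atTop atTop :=
    tendsto_atTop_add_const_right _ _ tendsto_natCast_atTop_atTop
  split_ifs with h
  · have hlt := lt_of_le_of_ne h hz.symm
    have : Tendsto (fun n : ℕ => ((n:ℝ) + 1) * (z - Real.exp (-1)) + s) atTop atTop :=
      tendsto_atTop_add_const_right _ _ (hn.atTop_mul_const (by linarith))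
    refine tendsto_const_nhds.congr' ?_
    filter_upwards [this.eventually (eventually_ge_atTop 1)] with n hn
    unfold ramp
    rw [min_eq_left hn, max_eq_left h, max_eq_right zero_le_one]
  · push Not at h
    have : Tendsto (fun n : ℕ => ((n:ℝ) + 1) * (z - Real.exp (-1)) + s) atTop atBot :=
      tendsto_atBot_add_const_right _ _ (hn.atTop_mul_const_of_neg (by linarith))
    refine tendsto_const_nhds.congr' ?_
    filter_upwards [this.eventually (eventually_le_atBot 0)] with n hn
    unfold ramp
    rw [max_eq_left ((min_le_right _ _).trans hn), zero_div]

lemma ramp_lower (n : ℕ) (z : ℝ) : ramp 0 n z ≤ if Real.exp (-1) ≤ z then 1 / z else 0 := by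
  unfold ramp
  split_ifs with h
  · rw [max_eq_left h]
    exact div_le_div_of_nonneg_right (max_le zero_le_one (min_le_left _ _)) ((Real.exp_pos _).le.trans h)
  · push Not at h
    have : ((n:ℝ) + 1) * (z - Real.exp (-1)) + 0 ≤ 0 := by
      have : (0:ℝ) ≤ (n:ℝ) + 1 := by positivity
      nlinarith
    rw [max_eq_left ((min_le_right _ _).trans this), zero_div]

lemma ramp_upper (n : ℕ) (z : ℝ) : (if Real.exp (-1) ≤ z then 1 / z else 0) ≤ ramp 1 n z := by
  unfold ramp
  split_ifs with h
  · rw [max_eq_left h]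
    have : 1 ≤ ((n:ℝ) + 1) * (z - Real.exp (-1)) + 1 := by
      have : (0:ℝ) ≤ (n:ℝ) + 1 := by positivity
      nlinarith
    rw [min_eq_left this, max_eq_right zero_le_one]
  · exact div_nonneg (le_max_left _ _) ((Real.exp_pos _).le.trans (le_max_right _ _))

lemma karamata {ν : Measure ℝ} (hpos : ∀ᵐ x ∂ν, 0 < x) (hint : Integrable (fun x => x ^ 2) ν)
    (hne : ν ≠ 0)
    (ρ : ℝ) (hρ : ρ ∈ Ioc (0:ℝ) 1)
    (hD : ∀ z, 0 < z → Tendsto (fun a => (∫ x, Real.exp (-(z * a * x)) * x ^ 3 ∂ν) /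
      (∫ x, Real.exp (-(a * x)) * x ^ 3 ∂ν)) (𝓝[>] 0) (𝓝 (z ^ (ρ - 1)))) :
    ∃ C, 0 < C ∧ Tendsto (fun a => (∫ y in Ioc 0 a⁻¹, y ^ 3 ∂ν) /
      (∫ x, Real.exp (-(a * x)) * x ^ 3 ∂ν)) (𝓝[>] 0) (𝓝 C) := by
  obtain ⟨P, hP, hP0, hP1, hPk, hPp⟩ := limit_law ρ hρ
  set h : ℝ → ℝ := fun z => if Real.exp (-1) ≤ z then 1 / z else 0 with hdef
  have hmeas : Measurable h :=
    Measurable.ite measurableSet_Ici (measurable_const.div measurable_id) measurable_const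
  have hbdd : ∀ z ∈ Icc (0:ℝ) 1, |h z| ≤ Real.exp 1 := by
    intro z hz
    have h1 : 0 ≤ h z := by
      simp only [hdef]; split_ifs
      · exact div_nonneg zero_le_one hz.1
      · exact le_rfl
    rw [abs_of_nonneg h1]
    exact (ramp_upper 0 z).trans ((le_abs_self _).trans (ramp_bdd 1 0 z))
  have hhint := P_int hP0 h hmeas _ hbdd
  have hlim : ∀ s : ℝ, Tendsto (fun n => ∫ y, ramp s n (Real.exp (-y)) ∂P) atTop
      (𝓝 (∫ y, h (Real.exp (-y)) ∂P)) := by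
    intro s
    refine tendsto_integral_of_dominated_convergence (fun _ => Real.exp 1) ?_ (integrable_const _) ?_ ?_
    · intro n
      exact ((ramp_cont s n).comp (by fun_prop)).aestronglyMeasurable
    · intro n
      exact Eventually.of_forall (fun y => ramp_bdd s n _)
    · filter_upwards [hP1] with y hy
      refine ramp_lim s _ (fun hc => hy ?_)
      have := Real.exp_injective hc
      linarith
  have hM : ∀ a, 0 < a → ∫ y in Ioc 0 a⁻¹, y ^ 3 ∂ν =
      ∫ x, h (Real.exp (-(a * x))) * (Real.exp (-(a * x)) * x ^ 3) ∂ν := by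
    intro a ha
    rw [← integral_indicator measurableSet_Ioc]
    refine integral_congr_ae ?_
    filter_upwards [hpos] with x hx
    have hiff : x ∈ Ioc 0 a⁻¹ ↔ Real.exp (-1) ≤ Real.exp (-(a * x)) := by
      rw [Real.exp_le_exp, neg_le_neg_iff, mem_Ioc, le_inv_comm₀ hx ha, ← one_div, le_div_iff₀ hx]
      exact ⟨fun h => h.2, fun h => ⟨hx, h⟩⟩
    by_cases hc : x ∈ Ioc 0 a⁻¹
    · rw [indicator_of_mem hc]
      simp only [hdef, if_pos (hiff.1 hc)]
      have := (Real.exp_pos (-(a * x))).ne'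
      field_simp
    · rw [indicator_of_notMem hc]
      simp only [hdef, if_neg (fun h' => hc (hiff.2 h')), zero_mul]
  refine ⟨∫ y, h (Real.exp (-y)) ∂P, ?_, ?_⟩
  · have h0 : 0 ≤ᵐ[P] fun y => h (Real.exp (-y)) := by
      refine Eventually.of_forall (fun y => ?_)
      simp only [hdef, Pi.zero_apply]; split_ifs
      · positivity
      · exact le_rfl
    refine lt_of_le_of_ne (integral_nonneg_of_ae h0) (fun h1 => hPp ?_)
    have h2 := (integral_eq_zero_iff_of_nonneg_ae h0 hhint).1 h1.symm
    have h3 : ∀ᵐ y ∂P, ¬ y ∈ Iic (1:ℝ) := by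
      filter_upwards [h2] with y hy hy1
      have : Real.exp (-1) ≤ Real.exp (-y) := Real.exp_le_exp.2 (neg_le_neg hy1)
      simp only [hdef, if_pos this, Pi.zero_apply] at hy
      have : 0 < 1 / Real.exp (-y) := by positivity
      linarith
    rw [ae_iff] at h3
    simp only [not_not] at h3
    exact h3
  · have hcmp : ∀ a, 0 < a → ∀ f g : ℝ → ℝ, Measurable f → Measurable g →
        (∀ z ∈ Icc (0:ℝ) 1, |f z| ≤ Real.exp 1) → (∀ z ∈ Icc (0:ℝ) 1, |g z| ≤ Real.exp 1) →
        (∀ z, f z ≤ g z) →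
        (∫ x, f (Real.exp (-(a * x))) * (Real.exp (-(a * x)) * x ^ 3) ∂ν) /
          (∫ x, Real.exp (-(a * x)) * x ^ 3 ∂ν) ≤
        (∫ x, g (Real.exp (-(a * x))) * (Real.exp (-(a * x)) * x ^ 3) ∂ν) /
          (∫ x, Real.exp (-(a * x)) * x ^ 3 ∂ν) := by
      intro a ha f g hf hg hfb hgb hfg
      have hDp : 0 < ∫ x, Real.exp (-(a * x)) * x ^ 3 ∂ν :=
        int_pos hpos hne _ (int_D hpos hint a ha) (fun x hx => by positivity)
      refine div_le_div_of_nonneg_right ?_ hDp.le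
      refine integral_mono_ae (kar_int hpos hint a ha f hf _ hfb) (kar_int hpos hint a ha g hg _ hgb) ?_
      filter_upwards [hpos] with x hx
      exact mul_le_mul_of_nonneg_right (hfg _) (by positivity)
    rw [tendsto_order]
    constructor
    · intro y hy
      obtain ⟨n, hn⟩ := ((hlim 0).eventually (lt_mem_nhds hy)).exists
      filter_upwards [(kar_cont hpos hint hne ρ hD P hP0 hPk _ (ramp_cont 0 n)).eventually (lt_mem_nhds hn),
        self_mem_nhdsWithin] with a h1 ha
      rw [hM a ha]
      exact h1.trans_le (hcmp a ha _ _ (ramp_cont 0 n).measurable hmeas (fun z _ => ramp_bdd 0 n z)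
        hbdd (ramp_lower n))
    · intro y hy
      obtain ⟨n, hn⟩ := ((hlim 1).eventually (gt_mem_nhds hy)).exists
      filter_upwards [(kar_cont hpos hint hne ρ hD P hP0 hPk _ (ramp_cont 1 n)).eventually (gt_mem_nhds hn),
        self_mem_nhdsWithin] with a h1 ha
      rw [hM a ha]
      exact (hcmp a ha _ _ hmeas (ramp_cont 1 n).measurable hbdd (fun z _ => ramp_bdd 1 n z)
        (ramp_upper n)).trans_lt h1

/-- minus the derivative of (1 - exp(-q x)) / x -/
def wk (q x : ℝ) : ℝ := (1 - Real.exp (-(q * x)) * (1 + q * x)) / x ^ 2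

lemma wk_meas (q : ℝ) : Measurable (wk q) := by unfold wk; fun_prop

lemma exp_anti (y z : ℝ) (hy : 0 ≤ y) (hyz : y < z) :
    Real.exp (-z) * (1 + z) < Real.exp (-y) * (1 + y) := by
  have h := Real.add_one_lt_exp (x := z - y) (by linarith)
  have h2 : Real.exp (-y) = Real.exp (z - y) * Real.exp (-z) := by
    rw [← Real.exp_add]; congr 1; ring
  rw [h2]
  have h3 : 1 + z < Real.exp (z - y) * (1 + y) := by nlinarith
  nlinarith [Real.exp_pos (-z)]

lemma wk_pos (q x : ℝ) (hq : 0 < q) (hx : 0 < x) : 0 < wk q x := by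
  unfold wk
  have := exp_anti 0 (q * x) le_rfl (mul_pos hq hx)
  simp at this
  refine div_pos (by linarith) (by positivity)

lemma wk_strict (q p x : ℝ) (hq : 0 < q) (hqp : q < p) (hx : 0 < x) : wk q x < wk p x := by
  unfold wk
  have := exp_anti (q * x) (p * x) (mul_pos hq hx).le (mul_lt_mul_of_pos_right hqp hx)
  exact div_lt_div_of_pos_right (by linarith) (by positivity)

lemma wk_scale (q b y : ℝ) (hb : 0 < b) : b ^ 2 * wk (q / b) (b * y) = wk q y := by
  unfold wk
  have : q / b * (b * y) = q * y := by field_simp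
  rw [this, mul_pow]
  by_cases hy : y = 0
  · simp [hy]
  · field_simp

lemma k_deriv (q x : ℝ) (hx : x ≠ 0) :
    HasDerivAt (fun x => -((1 - Real.exp (-(q * x))) / x)) (wk q x) x := by
  have h1 : HasDerivAt (fun x : ℝ => -(q * x)) (-(q * 1)) x := ((hasDerivAt_id x).const_mul q).neg
  have h2 := ((h1.exp.const_sub 1).div (hasDerivAt_id x) hx).neg
  refine h2.congr_deriv ?_
  simp only [id, wk]
  ring

lemma k_tendsto (q : ℝ) (hq : 0 < q) :
    Tendsto (fun x => -((1 - Real.exp (-(q * x))) / x)) atTop (𝓝 0) := by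
  have h1 : Tendsto (fun x : ℝ => x⁻¹) atTop (𝓝 0) := tendsto_inv_atTop_zero
  refine squeeze_zero_norm' ?_ h1
  filter_upwards [eventually_gt_atTop 0] with x hx
  have h2 : Real.exp (-(q * x)) ≤ 1 := Real.exp_le_one_iff.2 (by nlinarith)
  have h3 := Real.exp_pos (-(q * x))
  rw [norm_neg, Real.norm_of_nonneg (div_nonneg (by linarith) hx.le), div_eq_mul_inv]
  have : 0 < x⁻¹ := by positivity
  nlinarith

lemma wk_int_Ioi (q a : ℝ) (hq : 0 < q) (ha : 0 < a) :
    ∫ x in Ioi a, wk q x = (1 - Real.exp (-(q * a))) / a := by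
  have := integral_Ioi_of_hasDerivAt_of_nonneg' (a := a) (l := 0)
    (g := fun x => -((1 - Real.exp (-(q * x))) / x)) (g' := wk q)
    (fun x hx => k_deriv q x (ha.trans_le hx).ne') (fun x hx => (wk_pos q x hq (ha.trans hx)).le)
    (k_tendsto q hq)
  rw [this]; ring

lemma wk_zero (q : ℝ) (hq : 0 < q) :
    IntegrableOn (wk q) (Ioi 0) ∧ ∫ x in Ioi 0, wk q x = q := by
  set g : ℝ → ℝ := Function.update (fun x => -((1 - Real.exp (-(q * x))) / x)) 0 (-q) with hg
  have hgne : ∀ x, x ≠ 0 → g =ᶠ[𝓝 x] (fun x => -((1 - Real.exp (-(q * x))) / x)) := by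
    intro x hx
    filter_upwards [isOpen_ne.mem_nhds hx] with y hy
    simp [hg, Function.update_of_ne hy]
  have hcont : ContinuousAt g 0 := by
    rw [hg, continuousAt_update_same]
    have h1 : HasDerivAt (fun x : ℝ => -(q * x)) (-(q * 1)) 0 := ((hasDerivAt_id 0).const_mul q).neg
    have h2 := (h1.exp.const_sub 1).neg
    have h3 := hasDerivAt_iff_tendsto_slope.1 h2
    simp only [mul_zero, neg_zero, Real.exp_zero, mul_one, one_mul, neg_neg] at h3
    refine h3.congr (fun x => ?_)
    simp [slope_def_field]; ring
  have hder : ∀ x ∈ Ioi (0:ℝ), HasDerivAt g (wk q x) x := fun x hx =>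
    (k_deriv q x (ne_of_gt hx)).congr_of_eventuallyEq (hgne x (ne_of_gt hx))
  have hlim : Tendsto g atTop (𝓝 0) := by
    refine (k_tendsto q hq).congr' ?_
    filter_upwards [eventually_gt_atTop 0] with x hx
    exact ((hgne x (ne_of_gt hx)).self_of_nhds).symm
  have hp : ∀ x ∈ Ioi (0:ℝ), 0 ≤ wk q x := fun x hx => (wk_pos q x hq hx).le
  refine ⟨integrableOn_Ioi_deriv_of_nonneg hcont.continuousWithinAt hder hp hlim, ?_⟩
  rw [integral_Ioi_of_hasDerivAt_of_nonneg hcont.continuousWithinAt hder hp hlim]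
  simp [hg]

lemma wkV_int (q : ℝ) (hq : 0 < q) (V : ℝ → ℝ) (hm : Measurable V) (h0 : ∀ x, 0 ≤ V x)
    (h1 : ∀ x, V x ≤ 1) : IntegrableOn (fun x => wk q x * V x) (Ioi 0) := by
  refine Integrable.mul_bdd (c := 1) (wk_zero q hq).1 hm.aestronglyMeasurable ?_
  exact Eventually.of_forall (fun x => by rw [Real.norm_of_nonneg (h0 x)]; exact h1 x)

lemma set_int_pos (F : ℝ → ℝ) (hF : IntegrableOn F (Ioi 0)) (h0 : ∀ x, 0 < x → 0 ≤ F x)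
    (c d : ℝ) (hc : 0 ≤ c) (hcd : c < d) (h : ∀ x ∈ Ioo c d, 0 < F x) : 0 < ∫ x in Ioi 0, F x := by
  have hae : 0 ≤ᵐ[volume.restrict (Ioi 0)] F := by
    filter_upwards [ae_restrict_mem measurableSet_Ioi] with x hx using h0 x hx
  rw [setIntegral_pos_iff_support_of_nonneg_ae hae hF]
  refine lt_of_lt_of_le ?_ (measure_mono (?_ : Ioo c d ⊆ _))
  · simpa using hcd
  · intro x hx
    exact ⟨(h x hx).ne', hc.trans_lt hx.1⟩

/-- limit function -/
def Hf (V : ℝ → ℝ) (q : ℝ) : ℝ := ∫ x in Ioi 0, wk q x * V x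


lemma V_le_one (V : ℝ → ℝ) (hm : Monotone V)
    (h0 : ∀ x, 0 ≤ V x) (ht : Tendsto V atTop (𝓝 1)) (x : ℝ) : V x ≤ 1 := hm.ge_of_tendsto ht x

lemma V_pos_large (V : ℝ → ℝ) (hm : Monotone V)
    (h0 : ∀ x, 0 ≤ V x) (ht : Tendsto V atTop (𝓝 1)) : ∃ c, 0 < c ∧ ∀ x, c < x → 0 < V x := by
  obtain ⟨c, hc⟩ := ((ht.eventually (lt_mem_nhds one_pos)).and (eventually_gt_atTop 0)).exists
  exact ⟨c, hc.2, fun x hx => hc.1.trans_le (hm hx.le)⟩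

lemma Hf_pos (V : ℝ → ℝ) (hm : Monotone V)
    (h0 : ∀ x, 0 ≤ V x) (ht : Tendsto V atTop (𝓝 1)) (q : ℝ) (hq : 0 < q) : 0 < Hf V q := by
  obtain ⟨c, hc, hc'⟩ := V_pos_large V hm h0 ht
  refine set_int_pos _ (wkV_int q hq V hm.measurable h0 (V_le_one V hm h0 ht))
    (fun x hx => mul_nonneg (wk_pos q x hq hx).le (h0 x)) c (c + 1) hc.le (by linarith) ?_
  intro x hx
  exact mul_pos (wk_pos q x hq (hc.trans hx.1)) (hc' x hx.1)

lemma Hf_strict (V : ℝ → ℝ) (hm : Monotone V)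
    (h0 : ∀ x, 0 ≤ V x) (ht : Tendsto V atTop (𝓝 1)) : StrictMonoOn (Hf V) (Ioi 0) := by
  intro q hq p hp hqp
  obtain ⟨c, hc, hc'⟩ := V_pos_large V hm h0 ht
  have i1 := wkV_int q hq V hm.measurable h0 (V_le_one V hm h0 ht)
  have i2 := wkV_int p hp V hm.measurable h0 (V_le_one V hm h0 ht)
  have := set_int_pos (fun x => wk p x * V x - wk q x * V x) (i2.sub i1)
    (fun x hx => by
      have := wk_strict q p x hq hqp hx
      nlinarith [h0 x]) c (c + 1) hc.le (by linarith)
    (fun x hx => by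
      have := wk_strict q p x hq hqp (hc.trans hx.1)
      nlinarith [hc' x hx.1])
  rw [integral_sub i2 i1] at this
  unfold Hf
  linarith

lemma Hf_lip (V : ℝ → ℝ) (hm : Monotone V)
    (h0 : ∀ x, 0 ≤ V x) (ht : Tendsto V atTop (𝓝 1)) (q p : ℝ) (hq : 0 < q) (hqp : q ≤ p) : Hf V p - Hf V q ≤ p - q := by
  rcases hqp.eq_or_lt with rfl | hlt
  · simp
  have hp := hq.trans hlt
  have i1 := wkV_int q hq V hm.measurable h0 (V_le_one V hm h0 ht)
  have i2 := wkV_int p hp V hm.measurable h0 (V_le_one V hm h0 ht)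
  have j1 := wk_zero q hq
  have j2 := wk_zero p hp
  have e : p - q = ∫ x in Ioi 0, (wk p x - wk q x) := by
    rw [integral_sub j2.1 j1.1, j1.2, j2.2]
  unfold Hf
  rw [e, ← integral_sub i2 i1]
  refine setIntegral_mono_on (i2.sub i1) (j2.1.sub j1.1) measurableSet_Ioi (fun x hx => ?_)
  have := wk_strict q p x hq hlt hx
  have := V_le_one V hm h0 ht x
  nlinarith

lemma Hf_cont (V : ℝ → ℝ) (hm : Monotone V)
    (h0 : ∀ x, 0 ≤ V x) (ht : Tendsto V atTop (𝓝 1)) : ContinuousOn (Hf V) (Ioi 0) := by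
  refine (LipschitzOnWith.of_le_add (fun x hx y hy => ?_)).continuousOn
  rcases le_total x y with h | h
  · have := (Hf_strict V hm h0 ht).monotoneOn hx hy h
    have := dist_nonneg (x := x) (y := y)
    linarith
  · have := Hf_lip V hm h0 ht y x hy h
    rw [Real.dist_eq, abs_of_nonneg (by linarith)]
    linarith

lemma Hf_lt (V : ℝ → ℝ) (hm : Monotone V)
    (h0 : ∀ x, 0 ≤ V x) (ht : Tendsto V atTop (𝓝 1)) (hn : ∃ x : ℝ, 0 < x ∧ V x < 1) (q : ℝ) (hq : 0 < q) : Hf V q < q := by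
  obtain ⟨x0, hx0, hx1⟩ := hn
  have i1 := wkV_int q hq V hm.measurable h0 (V_le_one V hm h0 ht)
  have j1 := wk_zero q hq
  have := set_int_pos (fun x => wk q x - wk q x * V x) (j1.1.sub i1)
    (fun x hx => by
      have := wk_pos q x hq hx
      have := V_le_one V hm h0 ht x
      nlinarith) 0 x0 le_rfl hx0
    (fun x hx => by
      have := wk_pos q x hq hx.1
      have := (hm hx.2.le).trans_lt hx1
      nlinarith)
  rw [integral_sub j1.1 i1, j1.2] at this
  unfold Hf
  linarith

lemma Hf_scale (V : ℝ → ℝ) (q : ℝ) (hq : 0 < q) : Hf V q / q = ∫ x in Ioi 0, wk 1 x * V (x / q) := by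
  have := integral_comp_mul_left_Ioi (fun x => wk 1 x * V (x / q)) 0 hq
  simp only [mul_zero, smul_eq_mul] at this
  rw [← mul_right_inj' (inv_pos.2 hq).ne', ← this]
  have e : ∀ x, wk q x * V x = q ^ 2 * (wk 1 (q * x) * V (q * x / q)) := by
    intro x
    have := wk_scale q q x hq
    rw [div_self hq.ne'] at this
    rw [← this, mul_div_cancel_left₀ _ hq.ne']
    ring
  unfold Hf
  simp_rw [e]
  rw [integral_const_mul]
  field_simp

lemma Hf_ratio (V : ℝ → ℝ) (hm : Monotone V)
    (h0 : ∀ x, 0 ≤ V x) (ht : Tendsto V atTop (𝓝 1)) (hn : ∃ x : ℝ, 0 < x ∧ V x < 1) (q p : ℝ) (hq : 0 < q) (hqp : q < p) : Hf V p / p < Hf V q / q := by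
  have hp := hq.trans hqp
  rw [Hf_scale V q hq, Hf_scale V p hp]
  have hV1 := V_le_one V hm h0 ht
  have i1 := wkV_int 1 one_pos (fun x => V (x / q)) (hm.measurable.comp (measurable_id.div_const q))
    (fun x => h0 _) (fun x => hV1 _)
  have i2 := wkV_int 1 one_pos (fun x => V (x / p)) (hm.measurable.comp (measurable_id.div_const p))
    (fun x => h0 _) (fun x => hV1 _)
  have hle : ∀ x, 0 < x → V (x / p) ≤ V (x / q) := fun x hx =>
    hm (div_le_div_of_nonneg_left hx.le hq hqp.le)
  obtain ⟨x0, hx0, hx1⟩ := hn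
  set s := Real.sqrt (p / q) with hs
  have hs1 : 1 < s := by rw [hs, Real.lt_sqrt zero_le_one]; rw [one_pow, one_lt_div hq]; exact hqp
  have hss : s * s = p / q := Real.mul_self_sqrt (by positivity)
  have hs0 : 0 < s := one_pos.trans hs1
  obtain ⟨n, hn⟩ : ∃ n : ℕ, V (s ^ n * x0) < V (s ^ (n + 1) * x0) := by
    by_contra hcon
    push Not at hcon
    have hall : ∀ n : ℕ, V (s ^ n * x0) ≤ V x0 := by
      intro n
      induction n with
      | zero => simp
      | succ n ih => exact (hcon n).trans ih
    have hlim : Tendsto (fun n : ℕ => V (s ^ n * x0)) atTop (𝓝 1) :=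
      ht.comp ((tendsto_pow_atTop_atTop_of_one_lt hs1).atTop_mul_const hx0)
    have := le_of_tendsto' hlim hall
    linarith
  set y := s ^ n * x0 with hy
  have hy0 : 0 < y := by positivity
  have hy1 : s ^ (n + 1) * x0 = s * y := by rw [hy]; ring
  rw [hy1] at hn
  have := set_int_pos (fun x => wk 1 x * V (x / q) - wk 1 x * V (x / p)) (i1.sub i2)
    (fun x hx => by
      have := wk_pos 1 x one_pos hx
      nlinarith [hle x hx]) (p * y / s) (p * y) (by positivity) (div_lt_self (by positivity) hs1)
    (fun x hx => by
      have hx0 : 0 < x := lt_trans (by positivity) hx.1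
      have h1 := wk_pos 1 x one_pos hx0
      have h2 : V (x / p) ≤ V y := hm (by rw [div_le_iff₀ hp]; linarith [hx.2])
      have h3 : V (s * y) ≤ V (x / q) := by
        refine hm ?_
        have e : p = s * s * q := by rw [hss]; field_simp
        have := hx.1.le
        rw [div_le_iff₀ hs0] at this
        rw [le_div_iff₀ hq]
        rw [e] at this
        have : s * (s * y * q) ≤ s * x := by linarith
        exact le_of_mul_le_mul_left this hs0
      nlinarith)
  rw [integral_sub i1 i2] at this
  linarith



lemma layer_cake {μ : Measure ℝ} (hpos : ∀ᵐ x ∂μ, 0 < x) (hint : Integrable (fun x => x ^ 2) μ)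
    (s : ℝ) (hs : 0 < s) :
    ∫ x, (1 - Real.exp (-(s * x))) * x ∂μ =
      ∫ y in Ioi 0, wk s y * (∫ x in Ioc 0 y, x ^ 2 ∂μ) := by
  have hdm : Measurable (fun x : ℝ => ENNReal.ofReal (x ^ 2)) := by fun_prop
  set m := μ.withDensity (fun x => ENNReal.ofReal (x ^ 2)) with hmdef
  have hfin : IsFiniteMeasure m := isFiniteMeasure_withDensity_ofReal hint.2
  have hmpos : ∀ᵐ x ∂m, 0 < x := (withDensity_absolutelyContinuous _ _).ae_le hpos
  have hm_int : ∀ g : ℝ → ℝ, ∫ x, g x ∂m = ∫ x, x ^ 2 * g x ∂μ := by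
    intro g
    rw [hmdef, integral_withDensity_eq_integral_toReal_smul hdm
      (Eventually.of_forall (fun x => ENNReal.ofReal_lt_top))]
    refine integral_congr_ae (Eventually.of_forall (fun y => ?_))
    simp only [smul_eq_mul]
    rw [ENNReal.toReal_ofReal (sq_nonneg y)]
  set F : ℝ → ℝ → ℝ := fun x y => if x ≤ y then wk s y else 0 with hF
  have hFm : Measurable (Function.uncurry F) := by
    refine Measurable.ite (measurableSet_le measurable_fst measurable_snd)
      ((wk_meas s).comp measurable_snd) measurable_const
  have hFi : Integrable (Function.uncurry F) (m.prod (volume.restrict (Ioi 0))) := by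
    have h1 : Integrable (fun z : ℝ × ℝ => (1:ℝ) * wk s z.2) (m.prod (volume.restrict (Ioi 0))) :=
      (integrable_const (1:ℝ)).mul_prod (wk_zero s hs).1
    refine h1.mono hFm.aestronglyMeasurable (Eventually.of_forall (fun z => ?_))
    simp only [Function.uncurry, hF, one_mul]
    split_ifs
    · exact le_rfl
    · simp
  have hsw := integral_integral_swap hFi
  have hL : ∫ x, (∫ y in Ioi 0, F x y) ∂m = ∫ x, (1 - Real.exp (-(s * x))) * x ∂μ := by
    rw [hm_int]
    refine integral_congr_ae ?_
    filter_upwards [hpos] with x hx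
    have : ∫ y in Ioi 0, F x y = ∫ y in Ioi x, wk s y := by
      rw [← integral_Ici_eq_integral_Ioi (x := x), ← integral_indicator measurableSet_Ioi,
        ← integral_indicator measurableSet_Ici]
      congr 1
      ext y
      by_cases hxy : x ≤ y
      · rw [indicator_of_mem (show y ∈ Ioi 0 from hx.trans_le hxy), indicator_of_mem (show y ∈ Ici x from hxy)]
        simp [hF, hxy]
      · rw [indicator_of_notMem (show y ∉ Ici x from hxy)]
        simp [indicator, hF, hxy]
    rw [this, wk_int_Ioi s x hs hx]
    field_simp
  rw [← hL, hsw]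
  refine setIntegral_congr_fun measurableSet_Ioi (fun y hy => ?_)
  rw [hm_int, ← integral_indicator measurableSet_Ioc, ← integral_const_mul]
  refine integral_congr_ae ?_
  filter_upwards [hpos] with x hx
  by_cases hxy : x ≤ y
  · rw [indicator_of_mem (show x ∈ Ioc 0 y from ⟨hx, hxy⟩)]
    simp [hF, hxy]; ring
  · rw [indicator_of_notMem (show x ∉ Ioc 0 y from fun h => hxy h.2)]
    simp [hF, hxy]


lemma second_moment {μ : Measure ℝ} (hpos : ∀ᵐ x ∂μ, 0 < x) (f : ℝ → ℝ) (T : ℝ)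
    (hI : ∀ s, 0 < s → Integrable (fun x => (1 - Real.exp (-(s * x))) * x) μ)
    (hf : ∀ s, 0 < s → ∫ x, (1 - Real.exp (-(s * x))) * x ∂μ = f s)
    (hle : ∀ s, 0 < s → f s / s ≤ T)
    (hlim : Tendsto (fun s => f s / s) (𝓝[>] 0) (𝓝 T)) :
    Integrable (fun x => x ^ 2) μ ∧ ∫ x, x ^ 2 ∂μ = T := by
  set w : ℕ → ℝ := fun n => 1 / ((n:ℝ) + 1) with hw
  have wpos : ∀ n, 0 < w n := fun n => Nat.one_div_pos_of_nat
  have wlim : Tendsto w atTop (𝓝[>] 0) :=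
    tendsto_nhdsWithin_iff.2 ⟨tendsto_one_div_add_atTop_nhds_zero_nat,
      Eventually.of_forall (fun n => wpos n)⟩
  set F : ℕ → ℝ → ℝ := fun n x => (1 - Real.exp (-(w n * x))) * x / w n with hF
  have Fmeas : ∀ n, Measurable (F n) := fun n => by simp only [hF]; fun_prop
  have Fint : ∀ n, Integrable (F n) μ := fun n => (hI _ (wpos n)).div_const _
  have Fval : ∀ n, ∫ x, F n x ∂μ = f (w n) / w n := fun n => by
    simp only [hF]
    rw [integral_div, hf _ (wpos n)]
  have Fnn : ∀ n, ∀ x, 0 < x → 0 ≤ F n x ∧ F n x ≤ x ^ 2 := by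
    intro n x hx
    have h1 := Real.add_one_le_exp (-(w n * x))
    have h2 : Real.exp (-(w n * x)) ≤ 1 := Real.exp_le_one_iff.2 (by nlinarith [wpos n])
    refine ⟨div_nonneg (mul_nonneg (by linarith) hx.le) (wpos n).le, ?_⟩
    simp only [hF]
    rw [div_le_iff₀ (wpos n)]
    nlinarith
  have Flim : ∀ x, Tendsto (fun n => F n x) atTop (𝓝 (x ^ 2)) := by
    intro x
    have h1 : HasDerivAt (fun s : ℝ => -(s * x)) (-(1 * x)) 0 := ((hasDerivAt_id 0).mul_const x).neg
    have h2 := (h1.exp.const_sub 1).mul_const x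
    have h3 := hasDerivAt_iff_tendsto_slope.1 h2
    simp only [zero_mul, neg_zero, Real.exp_zero, one_mul, mul_neg, neg_neg, ← sq] at h3
    have h4 := (h3.mono_left (nhdsGT_le_nhdsNE 0)).comp wlim
    refine h4.congr (fun n => ?_)
    simp [slope_def_field, hF]
  have hlint : ∀ n, ∫⁻ x, ENNReal.ofReal (F n x) ∂μ ≤ ENNReal.ofReal T := by
    intro n
    rw [← ofReal_integral_eq_lintegral_ofReal (Fint n)
      (by filter_upwards [hpos] with x hx using (Fnn n x hx).1), Fval]
    exact ENNReal.ofReal_le_ofReal (hle _ (wpos n))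
  have hfat : ∫⁻ x, ENNReal.ofReal (x ^ 2) ∂μ ≤ ENNReal.ofReal T := by
    have h1 : ∀ x, ENNReal.ofReal (x ^ 2) = liminf (fun n => ENNReal.ofReal (F n x)) atTop :=
      fun x => ((ENNReal.tendsto_ofReal (Flim x)).liminf_eq).symm
    calc ∫⁻ x, ENNReal.ofReal (x ^ 2) ∂μ
        = ∫⁻ x, liminf (fun n => ENNReal.ofReal (F n x)) atTop ∂μ := by simp_rw [h1]
      _ ≤ liminf (fun n => ∫⁻ x, ENNReal.ofReal (F n x) ∂μ) atTop :=
          lintegral_liminf_le (fun n => (Fmeas n).ennreal_ofReal)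
      _ ≤ liminf (fun _ : ℕ => ENNReal.ofReal T) atTop :=
          liminf_le_liminf (Eventually.of_forall hlint)
      _ = ENNReal.ofReal T := by simp
  have hint : Integrable (fun x => x ^ 2) μ := by
    refine ⟨by fun_prop, ?_⟩
    rw [hasFiniteIntegral_iff_ofReal (Eventually.of_forall (fun x => sq_nonneg x))]
    exact hfat.trans_lt ENNReal.ofReal_lt_top
  refine ⟨hint, ?_⟩
  have h5 : Tendsto (fun n => ∫ x, F n x ∂μ) atTop (𝓝 (∫ x, x ^ 2 ∂μ)) := by
    refine tendsto_integral_of_dominated_convergence (fun x => x ^ 2)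
      (fun n => (Fmeas n).aestronglyMeasurable) hint (fun n => ?_)
      (Eventually.of_forall Flim)
    filter_upwards [hpos] with x hx
    rw [Real.norm_of_nonneg (Fnn n x hx).1]
    exact (Fnn n x hx).2
  simp_rw [Fval] at h5
  exact tendsto_nhds_unique h5 (hlim.comp wlim)


lemma psi_pos {ν : Measure ℝ} (hpos : ∀ᵐ x ∂ν, 0 < x)
    (hint : Integrable (fun x => x ^ 2) ν) (hne : ν ≠ 0) (a : ℝ) (ha : 0 < a) : 0 < ∫ x, (1 - Real.exp (-(a * x))) * x ∂ν := by
  refine int_pos hpos hne _ (int_psi hpos hint a ha.le) (fun x hx => ?_)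
  have h2 : Real.exp (-(a * x)) < 1 := Real.exp_lt_one_iff.2 (by nlinarith [mul_pos ha hx])
  exact mul_pos (by linarith) hx

lemma psi_lt {ν : Measure ℝ} (hpos : ∀ᵐ x ∂ν, 0 < x)
    (hint : Integrable (fun x => x ^ 2) ν) (h1 : ∫ x, x ^ 2 ∂ν = 1) (hne : ν ≠ 0) (a : ℝ) (ha : 0 < a) : ∫ x, (1 - Real.exp (-(a * x))) * x ∂ν < a := by
  have h2 := int_pos hpos hne (fun x => a * x ^ 2 - (1 - Real.exp (-(a * x))) * x)
    ((hint.const_mul a).sub (int_psi hpos hint a ha.le)) (fun x hx => by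
      have h := Real.add_one_lt_exp (x := -(a * x)) (by have := mul_pos ha hx; linarith)
      nlinarith)
  rw [integral_sub (hint.const_mul a) (int_psi hpos hint a ha.le), integral_const_mul, h1] at h2
  linarith

lemma Phi_le {ν : Measure ℝ} (hpos : ∀ᵐ x ∂ν, 0 < x)
    (hint : Integrable (fun x => x ^ 2) ν) (h1 : ∫ x, x ^ 2 ∂ν = 1) (a : ℝ) (ha : 0 < a) : a - ∫ x, (1 - Real.exp (-(a * x))) * x ∂ν ≤
    a * ∫ x, (1 - Real.exp (-(a * x))) * x ^ 2 ∂ν := by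
  have := tan_Phi hpos hint h1 a 0 ha.le le_rfl
  simp only [zero_mul, neg_zero, Real.exp_zero, sub_self, integral_zero] at this
  linarith

lemma U_mono {ν : Measure ℝ} (hpos : ∀ᵐ x ∂ν, 0 < x)
    (hint : Integrable (fun x => x ^ 2) ν) (h1 : ∫ x, x ^ 2 ∂ν = 1) : MonotoneOn (fun a => 1 - (∫ x, (1 - Real.exp (-(a * x))) * x ∂ν) / a) (Ioi 0) := by
  intro a ha b hb hab
  have ha : 0 < a := ha
  have hb : 0 < b := hb
  have e1 := Phi_le hpos hint h1 a ha
  have e2 := tan_Phi hpos hint h1 a b ha.le hb.le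
  simp only
  set p := ∫ x, (1 - Real.exp (-(a * x))) * x ∂ν
  set q := ∫ x, (1 - Real.exp (-(b * x))) * x ∂ν
  set u := ∫ x, (1 - Real.exp (-(a * x))) * x ^ 2 ∂ν
  have : q / b ≤ p / a := by
    rw [div_le_div_iff₀ hb ha]
    nlinarith [mul_le_mul_of_nonneg_left e1 (sub_nonneg.2 hab)]
  linarith

lemma U_pos {ν : Measure ℝ} (hpos : ∀ᵐ x ∂ν, 0 < x)
    (hint : Integrable (fun x => x ^ 2) ν) (h1 : ∫ x, x ^ 2 ∂ν = 1) (hne : ν ≠ 0) (a : ℝ) (ha : 0 < a) : 0 < 1 - (∫ x, (1 - Real.exp (-(a * x))) * x ∂ν) / a := by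
  have := (div_lt_one ha).2 (psi_lt hpos hint h1 hne a ha)
  linarith

lemma U_zero {ν : Measure ℝ} (hpos : ∀ᵐ x ∂ν, 0 < x)
    (hint : Integrable (fun x => x ^ 2) ν) (h1 : ∫ x, x ^ 2 ∂ν = 1) (hne : ν ≠ 0) : Tendsto (fun a => 1 - (∫ x, (1 - Real.exp (-(a * x))) * x ∂ν) / a) (𝓝[>] 0) (𝓝 0) := by
  refine squeeze_zero' ?_ ?_ (u_zero hpos hint)
  · filter_upwards [self_mem_nhdsWithin] with a ha using (U_pos hpos hint h1 hne a ha).le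
  · filter_upwards [self_mem_nhdsWithin] with a ha
    have ha : 0 < a := ha
    have := Phi_le hpos hint h1 a ha
    set p := ∫ x, (1 - Real.exp (-(a * x))) * x ∂ν
    have e : 1 - p / a = (a - p) / a := by field_simp
    rw [e, div_le_iff₀ ha]
    linarith



lemma time_moment {ν : Measure ℝ} (hpos : ∀ᵐ x ∂ν, 0 < x) (hint : Integrable (fun x => x ^ 2) ν)
    (h1 : ∫ x, x ^ 2 ∂ν = 1) (hne : ν ≠ 0) (ψ : ℝ → ℝ)
    (hψ : ∀ s, ψ s = ∫ x, (1 - Real.exp (-(s * x))) * x ∂ν)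
    {μ : Measure ℝ} (hposμ : ∀ᵐ x ∂μ, 0 < x) (t : ℝ) (ht : t ∈ Ico (0:ℝ) 1) (g : ℝ → ℝ)
    (hg : ∀ s, 0 < s → 0 < g s ∧ s = g s - t * ψ (g s))
    (hs : ∀ s, 0 < s → ∫ x, (1 - Real.exp (-(s * x))) * x ∂μ = ψ (g s)) :
    Integrable (fun x => x ^ 2) μ ∧ ∫ x, x ^ 2 ∂μ = (1 - t)⁻¹ := by
  have ψpos : ∀ a, 0 < a → 0 < ψ a := fun a ha => by rw [hψ]; exact psi_pos hpos hint hne a ha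
  have ψlt : ∀ a, 0 < a → ψ a < a := fun a ha => by rw [hψ]; exact psi_lt hpos hint h1 hne a ha
  have h1t : 0 < 1 - t := by linarith [ht.2]
  have ht0 := ht.1
  have hgle : ∀ s, 0 < s → (1 - t) * g s ≤ s := fun s hs => by
    obtain ⟨h, h'⟩ := hg s hs
    nlinarith [ψlt _ h]
  have gz : Tendsto g (𝓝[>] 0) (𝓝[>] 0) := by
    refine tendsto_nhdsWithin_iff.2 ⟨?_, ?_⟩
    · have h3 : Tendsto (fun s : ℝ => s / (1 - t)) (𝓝[>] 0) (𝓝 0) := by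
        have : Tendsto (fun s : ℝ => s / (1 - t)) (𝓝 0) (𝓝 (0 / (1 - t))) :=
          tendsto_id.div_const _
        rw [zero_div] at this
        exact this.mono_left nhdsWithin_le_nhds
      refine squeeze_zero' ?_ ?_ h3
      · filter_upwards [self_mem_nhdsWithin] with s hs using (hg s hs).1.le
      · filter_upwards [self_mem_nhdsWithin] with s hs
        rw [le_div_iff₀ h1t]
        linarith [hgle s hs]
    · filter_upwards [self_mem_nhdsWithin] with s hs using (hg s hs).1
  refine second_moment hposμ (fun s => ψ (g s)) _ (fun s hs' => ?_) hs (fun s hs' => ?_) ?_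
  · by_contra hc
    have := integral_undef hc
    rw [hs s hs'] at this
    exact (ψpos _ (hg s hs').1).ne' this
  · obtain ⟨h, h'⟩ := hg s hs'
    rw [← one_div, div_le_div_iff₀ hs' h1t]
    nlinarith [ψlt _ h]
  · have hU : Tendsto (fun s => 1 - ψ (g s) / g s) (𝓝[>] 0) (𝓝 0) := by
      have := (U_zero hpos hint h1 hne).comp gz
      refine this.congr (fun s => ?_)
      simp only [Function.comp, hψ]
    have hr : Tendsto (fun s => ψ (g s) / g s) (𝓝[>] 0) (𝓝 1) := by
      have := hU.const_sub 1
      simpa using this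
    have hfin : Tendsto (fun s => (ψ (g s) / g s) / (1 - t * (ψ (g s) / g s))) (𝓝[>] 0)
        (𝓝 (1 / (1 - t * 1))) :=
      hr.div ((hr.const_mul t).const_sub 1) (by rw [mul_one]; exact h1t.ne')
    rw [mul_one, one_div] at hfin
    refine hfin.congr' ?_
    filter_upwards [self_mem_nhdsWithin] with s hs'
    obtain ⟨h, h'⟩ := hg s hs'
    have e : (1 - t * (ψ (g s) / g s)) = s / g s := by
      rw [eq_div_iff h.ne']
      field_simp
      linarith
    rw [e]
    field_simp

lemma time_scaled {μ : Measure ℝ} (hposμ : ∀ᵐ x ∂μ, 0 < x) (t : ℝ) (ht : t ∈ Ico (0:ℝ) 1)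
    (hint : Integrable (fun x => x ^ 2) μ) (hone : ∫ x, x ^ 2 ∂μ = (1 - t)⁻¹)
    (V : ℝ → ℝ)
    (hV : ∀ x, V x = (∫ y in Set.Ioc (0:ℝ) x, y ^ 2 ∂μ) / (∫ y in Set.Ioi (0:ℝ), y ^ 2 ∂μ)) :
    Monotone V ∧ (∀ x, 0 ≤ V x) ∧ (∀ x, V x ≤ 1) ∧ ∀ q b, 0 < q → 0 < b →
      (1 - t) * b * (∫ x, (1 - Real.exp (-(q / b * x))) * x ∂μ) =
        ∫ y in Ioi 0, wk q y * V (b * y) := by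
  have h1t : 0 < 1 - t := by linarith [ht.2]
  have hI : ∫ y in Set.Ioi (0:ℝ), y ^ 2 ∂μ = (1 - t)⁻¹ := by
    rw [← hone, Measure.restrict_eq_self_of_ae_mem]
    exact hposμ
  have hV' : ∀ x, V x = (1 - t) * ∫ y in Set.Ioc (0:ℝ) x, y ^ 2 ∂μ := by
    intro x
    rw [hV, hI, div_inv_eq_mul, mul_comm]
  have hnn : ∀ s : Set ℝ, 0 ≤ᵐ[μ.restrict s] fun y : ℝ => y ^ 2 :=
    fun s => Eventually.of_forall (fun y => sq_nonneg y)
  refine ⟨?_, ?_, ?_, ?_⟩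
  · intro x y hxy
    rw [hV', hV']
    refine mul_le_mul_of_nonneg_left ?_ h1t.le
    exact setIntegral_mono_set hint.integrableOn (hnn _)
      (Eventually.of_forall (fun z hz => ⟨hz.1, hz.2.trans hxy⟩))
  · intro x
    rw [hV']
    exact mul_nonneg h1t.le (integral_nonneg_of_ae (hnn _))
  · intro x
    have e : (1:ℝ) = (1 - t) * ∫ x, x ^ 2 ∂μ := by rw [hone, mul_inv_cancel₀ h1t.ne']
    rw [hV']
    refine le_trans ?_ e.ge
    refine mul_le_mul_of_nonneg_left ?_ h1t.le
    exact setIntegral_le_integral hint (Eventually.of_forall (fun y => sq_nonneg y))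
  · intro q b hq hb
    rw [layer_cake hposμ hint (q / b) (div_pos hq hb)]
    have h := integral_comp_mul_left_Ioi
      (fun y => wk (q / b) y * (∫ x in Ioc 0 y, x ^ 2 ∂μ)) 0 hb
    rw [mul_zero, smul_eq_mul] at h
    have h' : ∫ y in Ioi 0, wk (q / b) y * (∫ x in Ioc 0 y, x ^ 2 ∂μ) =
        b * ∫ x in Ioi 0, wk (q / b) (b * x) * (∫ y in Ioc 0 (b * x), y ^ 2 ∂μ) := by
      rw [h]; field_simp
    rw [h', ← integral_const_mul, ← integral_const_mul]
    refine setIntegral_congr_fun measurableSet_Ioi (fun y hy => ?_)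
    simp only [hV']
    rw [← wk_scale q b y hb]
    ring

lemma final_part {ν : Measure ℝ} (hpos : ∀ᵐ x ∂ν, 0 < x) (hint : Integrable (fun x => x ^ 2) ν)
    (h1 : ∫ x, x ^ 2 ∂ν = 1) (hne : ν ≠ 0) (ρ : ℝ) (hρ : 0 < ρ)
    (hU : ∀ z, 0 < z → Tendsto (fun a => (1 - (∫ x, (1 - Real.exp (-(z * a * x))) * x ∂ν) / (z * a)) /
      (1 - (∫ x, (1 - Real.exp (-(a * x))) * x ∂ν) / a)) (𝓝[>] 0) (𝓝 (z ^ ρ))) :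
    ∃ ρ : ℝ, ρ ∈ Set.Ioc (0:ℝ) 1 ∧ ∃ L : ℝ → ℝ,
      (∀ x : ℝ, 0 < x → 0 < L x) ∧
      (∀ c : ℝ, 0 < c → Tendsto (fun x => L (c * x) / L x) atTop (𝓝 1)) ∧
      Tendsto (fun x => (∫ y in Set.Ioc (0:ℝ) x, y ^ 3 ∂ν) / (x ^ (1 - ρ) * L x))
        atTop (𝓝 1) := by
  have hu := density_index 1 (Or.inl rfl) (fun a => a - ∫ x, (1 - Real.exp (-(a * x))) * x ∂ν)
    (fun a => ∫ x, (1 - Real.exp (-(a * x))) * x ^ 2 ∂ν) (1 + ρ) (by linarith)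
    (fun a ha => by have := psi_lt hpos hint h1 hne a ha; linarith)
    (fun z hz => by
      have h := (hU z hz).const_mul z
      rw [Real.rpow_add hz, Real.rpow_one]
      refine h.congr' ?_
      filter_upwards [self_mem_nhdsWithin] with a ha
      have ha : 0 < a := ha
      have h3 := psi_lt hpos hint h1 hne a ha
      set p := ∫ x, (1 - Real.exp (-(z * a * x))) * x ∂ν
      set q := ∫ x, (1 - Real.exp (-(a * x))) * x ∂ν
      have e1 : 1 - p / (z * a) = (z * a - p) / (z * a) := by field_simp
      have e2 : 1 - q / a = (a - q) / a := by field_simp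
      have : a - q ≠ 0 := by linarith
      rw [e1, e2]
      field_simp)
    (fun a b ha hb => by
      have := tan_Phi hpos hint h1 a b ha.le hb.le
      linarith)
  have hupos : ∀ a, 0 < a → 0 < ∫ x, (1 - Real.exp (-(a * x))) * x ^ 2 ∂ν := fun a ha =>
    int_pos hpos hne _ (int_u hpos hint a ha.le) (fun x hx => by
      have h2 : Real.exp (-(a * x)) < 1 := Real.exp_lt_one_iff.2 (by nlinarith [mul_pos ha hx])
      exact mul_pos (by linarith) (by positivity))
  have hDpos : ∀ a, 0 < a → 0 < ∫ x, Real.exp (-(a * x)) * x ^ 3 ∂ν := fun a ha =>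
    int_pos hpos hne _ (int_D hpos hint a ha) (fun x hx => by positivity)
  have hD := density_index (-1) (Or.inr rfl) (fun a => ∫ x, (1 - Real.exp (-(a * x))) * x ^ 2 ∂ν)
    (fun a => ∫ x, Real.exp (-(a * x)) * x ^ 3 ∂ν) ρ hρ hupos
    (fun z hz => by
      have := hu.2 z hz
      rwa [add_sub_cancel_left] at this)
    (fun a b ha hb => by
      have := tan_u hpos hint a b ha hb.le
      linarith)
  have hρ1 : ρ ≤ 1 := by
    refine le_of_tendsto hD.1 ?_
    filter_upwards [self_mem_nhdsWithin] with a ha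
    have ha : 0 < a := ha
    rw [div_le_one (hupos a ha)]
    have := tan_u hpos hint a 0 ha le_rfl
    simp only [zero_mul, neg_zero, Real.exp_zero, sub_self, integral_zero] at this
    linarith
  obtain ⟨C, hC, hlim⟩ := karamata hpos hint hne ρ ⟨hρ, hρ1⟩ hD.2
  set D : ℝ → ℝ := fun a => ∫ x, Real.exp (-(a * x)) * x ^ 3 ∂ν with hDdef
  have hinv : Tendsto (fun x : ℝ => x⁻¹) atTop (𝓝[>] 0) := tendsto_inv_atTop_nhdsGT_zero
  refine ⟨ρ, ⟨hρ, hρ1⟩, fun x => C * D x⁻¹ * x ^ (ρ - 1), ?_, ?_, ?_⟩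
  · intro x hx
    exact mul_pos (mul_pos hC (hDpos _ (inv_pos.2 hx))) (Real.rpow_pos_of_pos hx _)
  · intro c hc
    have h := ((hD.2 c⁻¹ (inv_pos.2 hc)).comp hinv).mul_const (c ^ (ρ - 1))
    rw [← Real.mul_rpow (inv_pos.2 hc).le hc.le, inv_mul_cancel₀ hc.ne', Real.one_rpow] at h
    refine h.congr' ?_
    filter_upwards [eventually_gt_atTop 0] with x hx
    simp only [Function.comp]
    rw [mul_inv, Real.mul_rpow hc.le hx.le]
    have e1 := (hDpos _ (inv_pos.2 hx)).ne'
    have e2 := (Real.rpow_pos_of_pos hx (ρ - 1)).ne'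
    change D (c⁻¹ * x⁻¹) / D x⁻¹ * _ = _
    change D x⁻¹ ≠ 0 at e1
    field_simp
  · have h := (hlim.comp hinv).div_const C
    rw [div_self hC.ne'] at h
    refine h.congr' ?_
    filter_upwards [eventually_gt_atTop 0] with x hx
    simp only [Function.comp, inv_inv]
    have e1 := (hDpos _ (inv_pos.2 hx)).ne'
    change D x⁻¹ ≠ 0 at e1
    have e3 : x ^ (1 - ρ) * (C * D x⁻¹ * x ^ (ρ - 1)) = C * D x⁻¹ := by
      have : x ^ (1 - ρ) * x ^ (ρ - 1) = 1 := by
        rw [← Real.rpow_add hx]; simp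
      linear_combination C * D x⁻¹ * this
    rw [e3]
    change _ / D x⁻¹ / C = _
    field_simp

theorem multiplicative_kernel_scaling_necessity
    -- ν₀ : positive measure on (0,∞) with second moment ∫ x² ν₀(dx) = 1
    (ν₀ : Measure ℝ) (hν₀supp : ν₀ (Set.Iic 0) = 0)
    (hmom : ∫⁻ x, ENNReal.ofReal (x ^ 2) ∂ν₀ = 1)
    -- desingularized Laplace transform ψ₀(s) = ∫ (1−e^{−sx}) x ν₀(dx)
    (ψ₀ : ℝ → ℝ) (hψ₀ : ∀ s : ℝ, ψ₀ s = ∫ x, (1 - Real.exp (-(s * x))) * x ∂ν₀)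
    -- characteristic map: σ(τ,s) > 0 solves s = σ − (1 − e^{−τ}) ψ₀(σ)
    (σ : ℝ → ℝ → ℝ)
    (hσ : ∀ τ : ℝ, 0 ≤ τ → ∀ s : ℝ, 0 < s →
      0 < σ τ s ∧ s = σ τ s - (1 - Real.exp (-τ)) * ψ₀ (σ τ s))
    -- (ν t), 0 ≤ t < 1 is the solution:
    -- ∫ (1−e^{−sx}) x ν_t(dx) = (1−t)⁻¹ e^{−τ} ψ₀(σ(τ,s)) with τ = −log(1−t)
    (ν : ℝ → Measure ℝ)
    (hsol : ∀ t : ℝ, t ∈ Set.Ico (0:ℝ) 1 → (ν t) (Set.Iic 0) = 0 ∧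
      ∀ s : ℝ, 0 < s →
        ∫ x, (1 - Real.exp (-(s * x))) * x ∂(ν t) =
          (1 - t)⁻¹ * (Real.exp (-(-Real.log (1 - t))) *
            ψ₀ (σ (-Real.log (1 - t)) s)))
    -- second-moment distribution function V(t,x)
    (V : ℝ → ℝ → ℝ)
    (hV : ∀ t : ℝ, t ∈ Set.Ico (0:ℝ) 1 → ∀ x : ℝ,
      V t x = (∫ y in Set.Ioc (0:ℝ) x, y ^ 2 ∂(ν t)) /
        (∫ y in Set.Ioi (0:ℝ), y ^ 2 ∂(ν t)))
    -- rescaling λ(t) → ∞ as t → 1⁻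
    (lam : ℝ → ℝ) (hlam_pos : ∀ t : ℝ, t ∈ Set.Ico (0:ℝ) 1 → 0 < lam t)
    (hlam : Tendsto lam (𝓝[<] (1:ℝ)) atTop)
    -- V⋆ : nontrivial probability distribution function
    (Vstar : ℝ → ℝ)
    (hV_mono : Monotone Vstar)
    (hV_rc : ∀ x : ℝ, ContinuousWithinAt Vstar (Set.Ici x) x)
    (hV_nonneg : ∀ x : ℝ, 0 ≤ Vstar x)
    (hV_one : Tendsto Vstar atTop (𝓝 1))
    (hV_nontrivial : ∃ x : ℝ, 0 < x ∧ Vstar x < 1)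
    -- convergence V(t, λ(t) x) → V⋆(x) as t → 1⁻ at continuity points of V⋆
    (hconv : ∀ x : ℝ, 0 < x → ContinuousAt Vstar x →
      Tendsto (fun t => V t (lam t * x)) (𝓝[<] (1:ℝ)) (𝓝 (Vstar x))) :
    -- conclusion: ∫₀^x y³ ν₀(dy) ~ x^{1-ρ} L(x) as x → ∞, with 0 < ρ ≤ 1, L slowly varying
    ∃ ρ : ℝ, ρ ∈ Set.Ioc (0:ℝ) 1 ∧ ∃ L : ℝ → ℝ,
      (∀ x : ℝ, 0 < x → 0 < L x) ∧
      (∀ c : ℝ, 0 < c → Tendsto (fun x => L (c * x) / L x) atTop (𝓝 1)) ∧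
      Tendsto (fun x => (∫ y in Set.Ioc (0:ℝ) x, y ^ 3 ∂ν₀) / (x ^ (1 - ρ) * L x))
        atTop (𝓝 1) := by
  have hpos : ∀ᵐ x ∂ν₀, 0 < x := by
    rw [ae_iff]; simpa [Set.Iic] using hν₀supp
  have hint : Integrable (fun x => x ^ 2) ν₀ := by
    refine ⟨by fun_prop, ?_⟩
    rw [hasFiniteIntegral_iff_ofReal (Eventually.of_forall (fun x => sq_nonneg x)), hmom]
    exact ENNReal.one_lt_top
  have h1 : ∫ x, x ^ 2 ∂ν₀ = 1 := by
    rw [integral_eq_lintegral_of_nonneg_ae (Eventually.of_forall (fun x => sq_nonneg x))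
      (by fun_prop), hmom, ENNReal.toReal_one]
  have hne : ν₀ ≠ 0 := by
    rintro rfl
    simp at hmom
  have hpost : ∀ t ∈ Set.Ico (0:ℝ) 1, ∀ᵐ x ∂(ν t), 0 < x := fun t ht => by
    rw [ae_iff]; simpa [Set.Iic] using (hsol t ht).1
  have hexp : ∀ t ∈ Set.Ico (0:ℝ) 1, Real.exp (-(-Real.log (1 - t))) = 1 - t := fun t ht => by
    rw [neg_neg, Real.exp_log (by linarith [ht.2])]
  set g : ℝ → ℝ → ℝ := fun t s => σ (-Real.log (1 - t)) s with hgdef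
  have hg : ∀ t ∈ Set.Ico (0:ℝ) 1, ∀ s, 0 < s → 0 < g t s ∧ s = g t s - t * ψ₀ (g t s) := by
    intro t ht s hs
    have hτ : 0 ≤ -Real.log (1 - t) := by
      have := Real.log_nonpos (x := 1 - t) (by linarith [ht.2]) (by linarith [ht.1])
      linarith
    have h := hσ _ hτ s hs
    rw [hexp t ht, sub_sub_cancel] at h
    exact h
  have hs' : ∀ t ∈ Set.Ico (0:ℝ) 1, ∀ s, 0 < s →
      ∫ x, (1 - Real.exp (-(s * x))) * x ∂(ν t) = ψ₀ (g t s) := by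
    intro t ht s hs
    rw [(hsol t ht).2 s hs, hexp t ht, ← mul_assoc, inv_mul_cancel₀ (by linarith [ht.2]), one_mul]
  have hmt := fun t (ht : t ∈ Set.Ico (0:ℝ) 1) =>
    time_moment hpos hint h1 hne ψ₀ hψ₀ (hpost t ht) t ht (g t) (hg t ht) (hs' t ht)
  have hsc := fun t (ht : t ∈ Set.Ico (0:ℝ) 1) =>
    time_scaled (hpost t ht) t ht (hmt t ht).1 (hmt t ht).2 (V t) (hV t ht)
  have hmem : ∀ᶠ t in 𝓝[<] (1:ℝ), t ∈ Set.Ico (0:ℝ) 1 := Ico_mem_nhdsLT zero_lt_one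
  -- convergence of the scaled Laplace transforms
  have hlimA : ∀ q, 0 < q → Tendsto (fun t => (1 - t) * lam t * ψ₀ (g t (q / lam t)))
      (𝓝[<] (1:ℝ)) (𝓝 (Hf Vstar q)) := by
    intro q hq
    have hdct : Tendsto (fun t => ∫ y in Ioi 0, wk q y * V t (lam t * y)) (𝓝[<] (1:ℝ))
        (𝓝 (∫ y in Ioi 0, wk q y * Vstar y)) := by
      refine tendsto_integral_filter_of_dominated_convergence (wk q) ?_ ?_ (wk_zero q hq).1 ?_
      · filter_upwards [hmem] with t ht
        have hmV : Measurable (V t) := (hsc t ht).1.measurable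
        exact ((wk_meas q).mul (hmV.comp (measurable_const_mul _))).aestronglyMeasurable
      · filter_upwards [hmem] with t ht
        filter_upwards [ae_restrict_mem measurableSet_Ioi] with y hy
        have hw := wk_pos q y hq hy
        obtain ⟨-, hn, hl, -⟩ := hsc t ht
        rw [Real.norm_of_nonneg (mul_nonneg hw.le (hn _))]
        exact mul_le_of_le_one_right hw.le (hl _)
      · have hc : ∀ᵐ y ∂(volume : Measure ℝ), ContinuousAt Vstar y := by
          rw [ae_iff]
          exact hV_mono.countable_not_continuousAt.measure_zero _
        filter_upwards [ae_restrict_mem measurableSet_Ioi, ae_restrict_of_ae hc] with y hy hyc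
        exact (hconv y hy hyc).const_mul _
    refine hdct.congr' ?_
    filter_upwards [hmem] with t ht
    rw [← (hsc t ht).2.2.2 q (lam t) hq (hlam_pos t ht),
      hs' t ht _ (div_pos hq (hlam_pos t ht))]
  have hrev : Tendsto (fun ε : ℝ => 1 - ε) (𝓝[>] 0) (𝓝[<] 1) := by
    refine tendsto_nhdsWithin_iff.2 ⟨?_, ?_⟩
    · have : Tendsto (fun ε : ℝ => 1 - ε) (𝓝 0) (𝓝 (1 - 0)) := tendsto_id.const_sub 1
      rw [sub_zero] at this
      exact this.mono_left nhdsWithin_le_nhds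
    · filter_upwards [self_mem_nhdsWithin] with ε hε
      have hε : 0 < ε := hε
      simp only [Set.mem_Iio]; linarith
  have hmemε : ∀ᶠ ε in 𝓝[>] (0:ℝ), 1 - ε ∈ Set.Ico (0:ℝ) 1 := hrev.eventually hmem
  have hεpos : ∀ᶠ ε in 𝓝[>] (0:ℝ), 0 < ε := self_mem_nhdsWithin
  have hε0 : Tendsto (fun ε : ℝ => ε) (𝓝[>] 0) (𝓝 0) := nhdsWithin_le_nhds
  set S : ℝ → ℝ → ℝ := fun ε q => g (1 - ε) (q / lam (1 - ε)) with hSdef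
  set c : ℝ → ℝ := fun ε => lam (1 - ε) * ε with hcdef
  set U : ℝ → ℝ := fun a => 1 - ψ₀ a / a with hUdef
  have Ueq : U = fun a => 1 - (∫ x, (1 - Real.exp (-(a * x))) * x ∂ν₀) / a := by
    funext a; simp only [hUdef, hψ₀]
  have Umono : MonotoneOn U (Ioi 0) := by rw [Ueq]; exact U_mono hpos hint h1
  have Upos : ∀ a, 0 < a → 0 < U a := by rw [Ueq]; exact U_pos hpos hint h1 hne
  have Uzero : Tendsto U (𝓝[>] 0) (𝓝 0) := by rw [Ueq]; exact U_zero hpos hint h1 hne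
  have Hpos : ∀ q, 0 < q → 0 < Hf Vstar q := fun q hq => Hf_pos Vstar hV_mono hV_nonneg hV_one q hq
  have Hlt : ∀ q, 0 < q → Hf Vstar q < q := fun q hq =>
    Hf_lt Vstar hV_mono hV_nonneg hV_one hV_nontrivial q hq
  have Hcont := Hf_cont Vstar hV_mono hV_nonneg hV_one
  have cpos : ∀ᶠ ε in 𝓝[>] (0:ℝ), 0 < c ε := by
    filter_upwards [hmemε, hεpos] with ε h hε using mul_pos (hlam_pos _ h) hε
  have Spos : ∀ q, 0 < q → ∀ᶠ ε in 𝓝[>] (0:ℝ), 0 < S ε q := by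
    intro q hq
    filter_upwards [hmemε] with ε h using (hg _ h _ (div_pos hq (hlam_pos _ h))).1
  have hh1 : ∀ q, 0 < q → Tendsto (fun ε => c ε * S ε q) (𝓝[>] 0) (𝓝 (Hf Vstar q)) := by
    intro q hq
    have hA := (hlimA q hq).comp hrev
    have hB := (hε0.mul_const q).add ((hε0.const_sub 1).mul hA)
    rw [zero_mul, zero_add, sub_zero, one_mul] at hB
    refine hB.congr' ?_
    filter_upwards [hmemε] with ε h
    have hl := hlam_pos _ h
    have h3 := (hg _ h _ (div_pos hq hl)).2
    have h4 : q = lam (1 - ε) * (g (1 - ε) (q / lam (1 - ε))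
        - (1 - ε) * ψ₀ (g (1 - ε) (q / lam (1 - ε)))) := by
      rw [← h3]; field_simp
    simp only [Function.comp, hcdef, hSdef, sub_sub_cancel]
    linear_combination ε * h4
  have hh2 : ∀ q, 0 < q → Tendsto (fun ε => U (S ε q) / ε) (𝓝[>] 0) (𝓝 (q / Hf Vstar q - 1)) := by
    intro q hq
    have hA := (((tendsto_const_nhds (x := q)).div (hh1 q hq) (Hpos q hq).ne').sub_const 1).div (hε0.const_sub 1)
      (by norm_num)
    rw [sub_zero, div_one] at hA
    refine hA.congr' ?_
    have hε1 : ∀ᶠ ε in 𝓝[>] (0:ℝ), ε < 1 := hε0.eventually (gt_mem_nhds one_pos)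
    filter_upwards [hmemε, hεpos, Spos q hq, hε1] with ε h hε hS hε1
    have hl := hlam_pos _ h
    have h3 : q / lam (1 - ε) = S ε q - (1 - ε) * ψ₀ (S ε q) :=
      (hg _ h _ (div_pos hq hl)).2
    have h5 : q = lam (1 - ε) * (S ε q - (1 - ε) * ψ₀ (S ε q)) := by
      rw [← h3]; field_simp
    have h6 : 1 - ε ≠ 0 := by linarith
    simp only [hUdef, hcdef, Pi.div_apply]
    have h7 : q / (lam (1 - ε) * ε * S ε q) = (S ε q - (1 - ε) * ψ₀ (S ε q)) / (ε * S ε q) := by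
      rw [div_eq_div_iff (by positivity) (by positivity)]
      linear_combination (ε * S ε q) * h5
    rw [h7]
    field_simp
    ring
  have hrv := rv_main U (Hf Vstar) (fun q => q / Hf Vstar q - 1) c S Umono Upos Uzero cpos Spos
    hh1 hh2 Hcont
    (by
      intro q hq p hp hqp
      have hq : 0 < q := hq
      have hp : 0 < p := hp
      have h := Hf_ratio Vstar hV_mono hV_nonneg hV_one hV_nontrivial q p hq hqp
      have a1 := Hpos q hq
      have a2 := Hpos p hp
      rw [div_lt_div_iff₀ hp hq] at h
      have : q / Hf Vstar q < p / Hf Vstar p := by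
        rw [div_lt_div_iff₀ a1 a2]; linarith
      simp only; linarith)
    ((continuousOn_id.div Hcont (fun q hq => (Hpos q hq).ne')).sub continuousOn_const)
    (Hf_strict Vstar hV_mono hV_nonneg hV_one) Hpos (fun q hq => (Hlt q hq).le)
    (fun q hq => by
      have := (one_lt_div (Hpos q hq)).2 (Hlt q hq)
      linarith)
  obtain ⟨ρ, hρ, hUρ⟩ := rv_power U Umono Upos hrv
  rw [Ueq] at hUρ
  exact final_part hpos hint h1 hne ρ hρ hUρ
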